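/- arXiv:1412.4437 — 2 statements merged into one kernel-verified Lean document; each statement's English description precedes it below -/
import Mathlib

section
/- Let n ≥ 2, set ν = (n−2)/2, let B ⊂ ℝ^n be an open ball centered at the origin, and let f : B → ℝ be smooth with Δf + f = 0 on B. Then for every compact set K ⊂ B and every ε > 0 there exist N ∈ ℕ, homogeneous polynomials P_1, …, P_N of degrees ℓ_1, …, ℓ_N with ΔP_j = 0, and real constants c_1, …, c_N, such that sup_{x∈K} | f(x) − Σ_{j=1}^N c_j P_j(x) J_{ℓ_j+ν}(|x|)/|x|^{ℓ_j+ν} | < ε (the summands being extended smoothly across x = 0). -/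
open MeasureTheory Real

noncomputable section

/-- The Laplacian of a polynomial in `n` variables. -/
def polyLaplacian {n : ℕ} (P : MvPolynomial (Fin n) ℝ) : MvPolynomial (Fin n) ℝ :=
  ∑ i : Fin n, MvPolynomial.pderiv i (MvPolynomial.pderiv i P)

/-- The Euclidean Laplacian `Δf = Σᵢ ∂²f/∂xᵢ²` of a function on `ℝ^n`. -/
def laplacian {n : ℕ} (f : EuclideanSpace ℝ (Fin n) → ℝ) (x : EuclideanSpace ℝ (Fin n)) : ℝ :=
  ∑ i : Fin n,
    fderiv ℝ (fun y => fderiv ℝ f y (EuclideanSpace.single i 1)) x (EuclideanSpace.single i 1)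

/-- The Bessel function of the first kind `J_μ`, via its power series. -/
def besselJ (μ : ℝ) (r : ℝ) : ℝ :=
  ∑' k : ℕ, ((-1 : ℝ) ^ k / (k.factorial * Real.Gamma (k + μ + 1))) * (r / 2) ^ (2 * (k : ℝ) + μ)

/-! ### Zonal harmonics -/

/-- `polyLaplacian` as a linear map. -/
def polyLaplacianₗ (n : ℕ) : MvPolynomial (Fin n) ℝ →ₗ[ℝ] MvPolynomial (Fin n) ℝ :=
  ∑ i : Fin n, (MvPolynomial.pderiv i).toLinearMap ∘ₗ (MvPolynomial.pderiv i).toLinearMap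

lemma polyLaplacianₗ_apply {n : ℕ} (P : MvPolynomial (Fin n) ℝ) :
    polyLaplacianₗ n P = polyLaplacian P := by
  simp [polyLaplacianₗ, polyLaplacian]

/-- The polynomial `|x|²`. -/
def normSqPoly (n : ℕ) : MvPolynomial (Fin n) ℝ := ∑ i, MvPolynomial.X i ^ 2

/-- The linear form `x ↦ ⟨y, x⟩`. -/
def linearFormPoly {n : ℕ} (y : Fin n → ℝ) : MvPolynomial (Fin n) ℝ :=
  ∑ i, MvPolynomial.C (y i) * MvPolynomial.X i

lemma pderiv_normSqPoly {n : ℕ} (i : Fin n) :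
    MvPolynomial.pderiv i (normSqPoly n) = 2 * MvPolynomial.X i := by
  simp [normSqPoly, Derivation.leibniz_pow, MvPolynomial.pderiv_X, Pi.single_apply]

lemma pderiv_linearFormPoly {n : ℕ} (y : Fin n → ℝ) (i : Fin n) :
    MvPolynomial.pderiv i (linearFormPoly y) = MvPolynomial.C (y i) := by
  simp [linearFormPoly, MvPolynomial.pderiv_X, Pi.single_apply]

lemma isHomogeneous_normSqPoly (n : ℕ) : (normSqPoly n).IsHomogeneous 2 :=
  MvPolynomial.IsHomogeneous.sum _ _ _ fun i _ => by
    simpa using (MvPolynomial.isHomogeneous_X ℝ i).pow 2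

lemma isHomogeneous_linearFormPoly {n : ℕ} (y : Fin n → ℝ) :
    (linearFormPoly y).IsHomogeneous 1 :=
  MvPolynomial.IsHomogeneous.sum _ _ _ fun i _ => by
    simpa using (MvPolynomial.isHomogeneous_C _ (y i)).mul (MvPolynomial.isHomogeneous_X ℝ i)

lemma polyLaplacian_normSqPoly_pow_mul {n : ℕ} (y : Fin n → ℝ) (hy : ∑ i, y i ^ 2 = 1)
    (j k : ℕ) :
    polyLaplacian (normSqPoly n ^ j * linearFormPoly y ^ k) =
      MvPolynomial.C (2 * j * (n + 2 * j - 2 + 2 * k) : ℝ) *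
        (normSqPoly n ^ (j - 1) * linearFormPoly y ^ k) +
      MvPolynomial.C (k * (k - 1) : ℝ) * (normSqPoly n ^ j * linearFormPoly y ^ (k - 2)) := by
  have hN : ∑ i : Fin n, (MvPolynomial.X i : MvPolynomial (Fin n) ℝ) ^ 2 = normSqPoly n := rfl
  have hL : ∑ i : Fin n, MvPolynomial.C (y i) * (MvPolynomial.X i : MvPolynomial (Fin n) ℝ)
      = linearFormPoly y := rfl
  have hy' : ∑ i : Fin n, (MvPolynomial.C (y i) : MvPolynomial (Fin n) ℝ) ^ 2 = 1 := by
    simp_rw [← map_pow]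
    rw [← map_sum, hy, map_one]
  set N := normSqPoly n with hNdef
  set L := linearFormPoly y with hLdef
  have key : ∀ i : Fin n, MvPolynomial.pderiv i (MvPolynomial.pderiv i (N ^ j * L ^ k)) =
      2 * (j : MvPolynomial (Fin n) ℝ) * N ^ (j - 1) * L ^ k +
        (4 * (j : MvPolynomial (Fin n) ℝ) * ((j - 1 : ℕ) : MvPolynomial (Fin n) ℝ) * N ^ (j - 1 - 1) * L ^ k) *
        MvPolynomial.X i ^ 2 +
        (4 * (j : MvPolynomial (Fin n) ℝ) * (k : MvPolynomial (Fin n) ℝ) *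
          N ^ (j - 1) * L ^ (k - 1)) * (MvPolynomial.C (y i) * MvPolynomial.X i) +
        ((k : MvPolynomial (Fin n) ℝ) * ((k - 1 : ℕ) : MvPolynomial (Fin n) ℝ) * N ^ j * L ^ (k - 1 - 1)) *
        MvPolynomial.C (y i) ^ 2 := by
    intro i
    have h1 : MvPolynomial.pderiv i N = 2 * MvPolynomial.X i := pderiv_normSqPoly i
    have h2 : MvPolynomial.pderiv i L = MvPolynomial.C (y i) := pderiv_linearFormPoly y i
    have h3 : MvPolynomial.pderiv i (2 : MvPolynomial (Fin n) ℝ) = 0 := by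
      exact_mod_cast (MvPolynomial.pderiv i).map_natCast 2
    simp only [Derivation.leibniz, Derivation.leibniz_pow, h1, h2, h3, smul_eq_mul, nsmul_eq_mul,
      map_add, MvPolynomial.pderiv_C, MvPolynomial.pderiv_X_self, Derivation.map_natCast]
    ring
  unfold polyLaplacian
  simp_rw [key]
  simp only [Finset.sum_add_distrib, ← Finset.mul_sum, hN, hL, hy', Finset.sum_const,
    Finset.card_univ, Fintype.card_fin, nsmul_eq_mul]
  have e1 : (j : MvPolynomial (Fin n) ℝ) * (j - 1 : ℕ) * N ^ (j - 1 - 1) * N =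
      j * (j - 1) * N ^ (j - 1) := by
    rcases j with _ | _ | j <;> simp [pow_succ]; ring
  have e2 : (k : MvPolynomial (Fin n) ℝ) * L ^ (k - 1) * L = k * L ^ k := by
    rcases k with _ | k <;> simp [pow_succ]; ring
  have e3 : (k : MvPolynomial (Fin n) ℝ) * (k - 1 : ℕ) = k * (k - 1) := by
    rcases k with _ | k <;> simp
  simp only [map_mul, map_add, map_sub, map_natCast, map_one, map_ofNat, Nat.sub_sub] at e1 e2 e3 ⊢
  norm_num at e1 e2 ⊢
  linear_combination 4 * L ^ k * e1 + 4 * j * N ^ (j - 1) * e2 + N ^ j * L ^ (k - 2) * e3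

/-- Coefficients of the zonal harmonic `∑ⱼ bⱼ |x|^{2j} ⟨y, x⟩^{m-2j}` in dimension `n`. -/
def zonalCoeff (n m : ℕ) : ℕ → ℝ
  | 0 => 1
  | j + 1 => -(zonalCoeff n m j * ((m - 2 * j) * (m - 2 * j - 1))) /
      (2 * (j + 1) * (n + 2 * m - 2 * j - 4))

/-- The zonal harmonic of degree `m` with pole `y`. -/
def zonalPoly {n : ℕ} (m : ℕ) (y : Fin n → ℝ) : MvPolynomial (Fin n) ℝ :=
  ∑ j ∈ Finset.range (m / 2 + 1),
    MvPolynomial.C (zonalCoeff n m j) * (normSqPoly n ^ j * linearFormPoly y ^ (m - 2 * j))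

/-- The profile of the zonal harmonic of degree `m` in dimension `n`,
a multiple of a Gegenbauer polynomial. -/
def zonalProfile (n m : ℕ) : Polynomial ℝ :=
  ∑ j ∈ Finset.range (m / 2 + 1), Polynomial.C (zonalCoeff n m j) * Polynomial.X ^ (m - 2 * j)

lemma isHomogeneous_zonalPoly {n : ℕ} (m : ℕ) (y : Fin n → ℝ) :
    (zonalPoly m y).IsHomogeneous m := by
  refine MvPolynomial.IsHomogeneous.sum _ _ _ fun j hj => ?_
  have h := (MvPolynomial.isHomogeneous_C (Fin n) (zonalCoeff n m j)).mul
    (((isHomogeneous_normSqPoly n).pow j).mul ((isHomogeneous_linearFormPoly y).pow (m - 2 * j)))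
  convert h using 1
  have := Finset.mem_range.1 hj
  omega

lemma polyLaplacian_zonalPoly {n : ℕ} (hn : 2 ≤ n) (m : ℕ) (y : Fin n → ℝ)
    (hy : ∑ i, y i ^ 2 = 1) : polyLaplacian (zonalPoly m y) = 0 := by
  have key : ∀ J ≤ m / 2, polyLaplacianₗ n (∑ j ∈ Finset.range (J + 1),
      MvPolynomial.C (zonalCoeff n m j) * (normSqPoly n ^ j * linearFormPoly y ^ (m - 2 * j))) =
      MvPolynomial.C (zonalCoeff n m J * ((m - 2 * J) * (m - 2 * J - 1))) *
        (normSqPoly n ^ J * linearFormPoly y ^ (m - 2 * J - 2)) := by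
    intro J
    induction J with
    | zero =>
      intro _
      rw [Finset.sum_range_one, ← MvPolynomial.smul_eq_C_mul, map_smul, polyLaplacianₗ_apply,
        polyLaplacian_normSqPoly_pow_mul y hy]
      simp [zonalCoeff]
    | succ J ih =>
      intro hJ
      rw [Finset.sum_range_succ, map_add, ih (by omega), ← MvPolynomial.smul_eq_C_mul _ (zonalCoeff _ _ _),
        map_smul, polyLaplacianₗ_apply, polyLaplacian_normSqPoly_pow_mul y hy]
      have hm : 2 * (J + 1) ≤ m := by omega
      have hcast : ((m - 2 * (J + 1) : ℕ) : ℝ) = m - 2 * (J + 1) := by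
        push_cast [Nat.cast_sub hm]; ring
      have hmR : (2 * (J + 1) : ℝ) ≤ m := by exact_mod_cast hm
      have hnR : (2 : ℝ) ≤ n := by exact_mod_cast hn
      have hJ0 : (0 : ℝ) ≤ J := J.cast_nonneg
      have hden : (n + 2 * m - 2 * J - 4 : ℝ) ≠ 0 := by
        have : (0 : ℝ) < n + 2 * m - 2 * J - 4 := by linarith
        exact this.ne'
      have hJ1 : (J + 1 : ℝ) ≠ 0 := by positivity
      have hb : zonalCoeff n m (J + 1) * (2 * (J + 1) * (n + 2 * (J + 1) - 2 +
          2 * (m - 2 * (J + 1)))) = -(zonalCoeff n m J * ((m - 2 * J) * (m - 2 * J - 1))) := by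
        rw [zonalCoeff, show (n + 2 * (J + 1) - 2 + 2 * (m - 2 * (J + 1)) : ℝ) =
          n + 2 * m - 2 * J - 4 by ring]
        exact div_mul_cancel₀ _ (mul_ne_zero (mul_ne_zero two_ne_zero hJ1) hden)
      have hsub : m - 2 * J - 2 = m - 2 * (J + 1) := by omega
      have hbC := congrArg (MvPolynomial.C (σ := Fin n)) hb
      rw [hcast, hsub]
      push_cast
      simp only [smul_add, MvPolynomial.smul_eq_C_mul, map_mul, map_neg] at hbC ⊢
      linear_combination (normSqPoly n ^ J * linearFormPoly y ^ (m - 2 * (J + 1))) * hbC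
  rw [← polyLaplacianₗ_apply, zonalPoly, key _ le_rfl]
  have : ((m : ℝ) - 2 * (m / 2 : ℕ)) * (m - 2 * (m / 2 : ℕ) - 1) = 0 := by
    rcases Nat.even_or_odd' m with ⟨c, hc | hc⟩
    · have : m / 2 = c := by omega
      rw [this, hc]; push_cast; ring
    · have : m / 2 = c := by omega
      rw [this, hc]; push_cast; ring
  rw [this]
  simp

lemma eval_zonalPoly {n : ℕ} (m : ℕ) (y x : Fin n → ℝ) (hx : ∑ i, x i ^ 2 = 1) :
    MvPolynomial.eval x (zonalPoly m y) = (zonalProfile n m).eval (∑ i, y i * x i) := by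
  simp [zonalPoly, zonalProfile, normSqPoly, linearFormPoly, Polynomial.eval_finsetSum, hx]

lemma zonalProfile_degree (n m : ℕ) : (zonalProfile n m).degree = m := by
  rw [zonalProfile, Finset.sum_range_succ', zonalCoeff, Polynomial.C_1, one_mul, mul_zero,
    Nat.sub_zero, Polynomial.degree_add_eq_right_of_degree_lt, Polynomial.degree_X_pow]
  rw [Polynomial.degree_X_pow]
  refine (Polynomial.degree_sum_le _ _).trans_lt ?_
  rw [Finset.sup_lt_iff (WithBot.bot_lt_coe _)]
  intro j hj
  refine (Polynomial.degree_C_mul_X_pow_le _ _).trans_lt ?_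
  have := Finset.mem_range.1 hj
  exact_mod_cast (by omega : m - 2 * (j + 1) < m)

/-- The zonal profiles span all polynomials. -/
lemma exists_eq_sum_zonalProfile (n : ℕ) (p : Polynomial ℝ) :
    ∃ κ : ℕ →₀ ℝ, p = ∑ m ∈ κ.support, κ m • zonalProfile n m := by
  let S : Polynomial.Sequence ℝ := ⟨zonalProfile n, zonalProfile_degree n⟩
  have hS : p ∈ Submodule.span ℝ (Set.range S) := by
    rw [S.span fun i => (Polynomial.leadingCoeff_ne_zero.2 (S.ne_zero i)).isUnit]
    trivial
  obtain ⟨κ, hκ⟩ := Finsupp.mem_span_range_iff_exists_finsupp.1 hS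
  exact ⟨κ, hκ.symm⟩

/-! ### The entire function `J_μ(r) / r^μ` in the variable `r²` -/

/-- The power series `∑ₖ (-1)^k / (k! Γ(k+μ+1)) (s/4)^k`, so that
`J_μ(r) = (r/2)^μ * besselEntire μ (r²)`. -/
def besselEntire (μ s : ℝ) : ℝ :=
  ∑' k : ℕ, (-1 : ℝ) ^ k / (k.factorial * Gamma (k + μ + 1)) * (s / 4) ^ k

lemma Gamma_add_natCast_add_one_ge {μ : ℝ} (hμ : 0 ≤ μ) (k : ℕ) :
    (μ + 1) ^ k * Gamma (μ + 1) ≤ Gamma (k + μ + 1) := by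
  induction k with
  | zero => simp
  | succ k ih =>
    have h : Gamma ((k + 1 : ℕ) + μ + 1) = (k + μ + 1) * Gamma (k + μ + 1) := by
      rw [← Gamma_add_one (by positivity)]
      push_cast
      ring_nf
    have hk : (0 : ℝ) ≤ k := k.cast_nonneg
    have hG : 0 < Gamma (k + μ + 1) := Gamma_pos_of_pos (by positivity)
    calc (μ + 1) ^ (k + 1) * Gamma (μ + 1) = (μ + 1) * ((μ + 1) ^ k * Gamma (μ + 1)) := by ring
      _ ≤ (k + μ + 1) * Gamma (k + μ + 1) := by gcongr; linarith
      _ = _ := h.symm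

lemma norm_besselEntire_term_le {μ : ℝ} (hμ : 0 ≤ μ) (s : ℝ) (k : ℕ) :
    ‖(-1 : ℝ) ^ k / (k.factorial * Gamma (k + μ + 1)) * (s / 4) ^ k‖ ≤
      (Gamma (μ + 1))⁻¹ * ((|s| / (4 * (μ + 1))) ^ k / k.factorial) := by
  have hG : 0 < Gamma (μ + 1) := Gamma_pos_of_pos (by positivity)
  have hG' : 0 < Gamma (k + μ + 1) := Gamma_pos_of_pos (by positivity)
  have hf : (0 : ℝ) < k.factorial := by positivity
  rw [norm_mul, norm_div, norm_pow, norm_pow, norm_neg, norm_one, one_pow, norm_mul, norm_div,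
    Real.norm_of_nonneg hf.le, Real.norm_of_nonneg hG'.le, Real.norm_eq_abs, Real.norm_eq_abs,
    abs_of_pos (by norm_num : (0 : ℝ) < 4)]
  calc 1 / (k.factorial * Gamma (k + μ + 1)) * (|s| / 4) ^ k
      ≤ 1 / (k.factorial * ((μ + 1) ^ k * Gamma (μ + 1))) * (|s| / 4) ^ k := by
        gcongr
        exact Gamma_add_natCast_add_one_ge hμ k
    _ = _ := by
        rw [div_pow, div_pow, mul_pow]
        field_simp

lemma summable_besselEntire {μ : ℝ} (hμ : 0 ≤ μ) (s : ℝ) :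
    Summable fun k : ℕ => (-1 : ℝ) ^ k / (k.factorial * Gamma (k + μ + 1)) * (s / 4) ^ k :=
  Summable.of_norm_bounded ((Real.summable_pow_div_factorial _).mul_left _)
    (norm_besselEntire_term_le hμ s)

lemma besselEntire_recurrence {μ : ℝ} (hμ : 0 ≤ μ) (s : ℝ) :
    besselEntire μ s = (μ + 1) * besselEntire (μ + 1) s - s / 4 * besselEntire (μ + 2) s := by
  have h1 := summable_besselEntire hμ s
  have h2 := summable_besselEntire (add_nonneg hμ zero_le_one) s
  have h3 := summable_besselEntire (add_nonneg hμ zero_le_two) s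
  have h4 : (μ + 1) * besselEntire (μ + 1) s - besselEntire μ s =
      s / 4 * besselEntire (μ + 2) s := by
    unfold besselEntire
    rw [← tsum_mul_left, ← tsum_mul_left, ← (h2.mul_left _).tsum_sub h1,
      ((h2.mul_left _).sub h1).tsum_eq_zero_add]
    have h0 : ∀ k : ℕ, Gamma (k + (μ + 1) + 1) = (k + μ + 1) * Gamma (k + μ + 1) := by
      intro k
      rw [← Gamma_add_one (by positivity)]
      ring_nf
    have hz : (μ + 1) * ((-1 : ℝ) ^ 0 / ((Nat.factorial 0) * Gamma ((0 : ℕ) + (μ + 1) + 1)) *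
        (s / 4) ^ 0) - (-1 : ℝ) ^ 0 / ((Nat.factorial 0) * Gamma ((0 : ℕ) + μ + 1)) *
        (s / 4) ^ 0 = 0 := by
      have hG : Gamma (μ + 1) ≠ 0 := (Gamma_pos_of_pos (by positivity)).ne'
      rw [h0]
      simp only [pow_zero, Nat.factorial_zero, Nat.cast_one, Nat.cast_zero, zero_add]
      field_simp
      ring
    rw [hz, zero_add]
    refine tsum_congr fun k => ?_
    have e1 : Gamma ((k + 1 : ℕ) + (μ + 1) + 1) = (k + 1 + μ + 1) * Gamma (k + (μ + 2)) := by
      rw [h0]; push_cast; ring_nf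
    have e2 : Gamma ((k + 1 : ℕ) + μ + 1) = Gamma (k + (μ + 2)) := by push_cast; ring_nf
    have e3 : Gamma (k + (μ + 2) + 1) = (k + 1 + μ + 1) * Gamma (k + (μ + 2)) := by
      rw [Gamma_add_one (by positivity)]; ring_nf
    have hG : Gamma (k + (μ + 2)) ≠ 0 := (Gamma_pos_of_pos (by positivity)).ne'
    have hk : (k + 1 + μ + 1 : ℝ) ≠ 0 := by positivity
    rw [e1, e2, e3, Nat.factorial_succ]
    push_cast
    field_simp
    ring
  linarith

lemma hasDerivAt_besselEntire {μ : ℝ} (hμ : 0 ≤ μ) (s : ℝ) :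
    HasDerivAt (besselEntire μ) (-(1 / 4) * besselEntire (μ + 1) s) s := by
  have hμ' : 0 ≤ μ + 1 := by linarith
  set c : ℕ → ℝ := fun k => (-1 : ℝ) ^ k / (k.factorial * Gamma (k + μ + 1)) with hc
  set M := |s| + 1 with hM
  have hterm : ∀ (k : ℕ) (y : ℝ), c (k + 1) * ((k + 1 : ℕ) * (y / 4) ^ k * (1 / 4)) =
      -(1 / 4) * ((-1 : ℝ) ^ k / (k.factorial * Gamma (k + (μ + 1) + 1)) * (y / 4) ^ k) := by
    intro k y
    have e : Gamma ((k + 1 : ℕ) + μ + 1) = Gamma (k + (μ + 1) + 1) := by push_cast; ring_nf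
    have hG : Gamma (k + (μ + 1) + 1) ≠ 0 := (Gamma_pos_of_pos (by positivity)).ne'
    simp only [hc]
    rw [e, Nat.factorial_succ]
    push_cast
    field_simp
    ring
  let u : ℕ → ℝ := fun k => Nat.casesOn k 0 fun k =>
    1 / 4 * ((Gamma (μ + 1 + 1))⁻¹ * ((M / (4 * (μ + 1 + 1))) ^ k / k.factorial))
  have hu : Summable u := by
    rw [← summable_nat_add_iff 1]
    exact ((Real.summable_pow_div_factorial _).mul_left _).mul_left _
  have hs : s ∈ Metric.ball (0 : ℝ) M := by simp [hM]
  have h := hasDerivAt_tsum_of_isPreconnected (g := fun k y => c k * (y / 4) ^ k)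
    (g' := fun k y => c k * (k * (y / 4) ^ (k - 1) * (1 / 4))) (u := u) hu
    (Metric.isOpen_ball (x := (0 : ℝ)) (ε := M)) (convex_ball _ _).isPreconnected
    (fun k y _ => (((hasDerivAt_id y).div_const 4).pow k).const_mul (c k)) ?_ hs
    (summable_besselEntire hμ s) hs
  · have hs' : Summable fun k : ℕ => c k * (k * (s / 4) ^ (k - 1) * (1 / 4)) := by
      rw [← summable_nat_add_iff 1]
      simp only [Nat.add_sub_cancel, hterm]
      exact (summable_besselEntire hμ' s).mul_left _
    refine h.congr_deriv ?_
    rw [hs'.tsum_eq_zero_add]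
    simp only [Nat.add_sub_cancel, hterm, tsum_mul_left]
    simp [besselEntire]
  · rintro (_ | k) y hy
    · simp [u]
    · have hy' : |y| ≤ M := by simpa using (mem_ball_zero_iff.1 hy).le
      simp only [Nat.add_sub_cancel, hterm, u]
      rw [norm_mul, show ‖(-(1 / 4) : ℝ)‖ = 1 / 4 by norm_num]
      have hG : 0 < Gamma (μ + 1 + 1) := Gamma_pos_of_pos (by positivity)
      refine mul_le_mul_of_nonneg_left ((norm_besselEntire_term_le hμ' y k).trans ?_) (by norm_num)
      gcongr

lemma contDiff_besselEntire {μ : ℝ} (hμ : 0 ≤ μ) :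
    ContDiff ℝ (⊤ : ℕ∞) (besselEntire μ) := by
  rw [contDiff_infty]
  intro m
  induction m generalizing μ with
  | zero =>
    exact contDiff_zero.2 (continuous_iff_continuousAt.2
      fun s => (hasDerivAt_besselEntire hμ s).continuousAt)
  | succ m ih =>
    rw [Nat.cast_succ, contDiff_succ_iff_deriv]
    refine ⟨fun s => (hasDerivAt_besselEntire hμ s).differentiableAt, by simp, ?_⟩
    rw [funext fun s => (hasDerivAt_besselEntire hμ s).deriv]
    exact contDiff_const.mul (ih (by linarith))

lemma besselEntire_ne_zero_of_le {μ s : ℝ} (hμ : 0 ≤ μ) (hs : |s| ≤ μ + 1) :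
    besselEntire μ s ≠ 0 := by
  have hG : 0 < Gamma (μ + 1) := Gamma_pos_of_pos (by positivity)
  set x := |s| / (4 * (μ + 1)) with hx
  have hx0 : 0 ≤ x := by positivity
  have hx1 : x ≤ 1 / 4 := by
    rw [hx, div_le_iff₀ (by positivity)]
    linarith
  have hsum := summable_besselEntire hμ s
  have hgeo : Summable fun k : ℕ => (Gamma (μ + 1))⁻¹ * (x * (1 / 4) ^ k) :=
    ((summable_geometric_of_lt_one (by norm_num) (by norm_num)).mul_left _).mul_left _
  have htail : ‖∑' k : ℕ, (-1 : ℝ) ^ (k + 1) / ((k + 1).factorial *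
      Gamma ((k + 1 : ℕ) + μ + 1)) * (s / 4) ^ (k + 1)‖ ≤
      ∑' k : ℕ, (Gamma (μ + 1))⁻¹ * (x * (1 / 4) ^ k) := by
    refine tsum_of_norm_bounded hgeo.hasSum fun k => ?_
    refine (norm_besselEntire_term_le hμ s (k + 1)).trans ?_
    rw [← hx]
    refine mul_le_mul_of_nonneg_left ?_ (by positivity)
    calc x ^ (k + 1) / (k + 1).factorial ≤ x ^ (k + 1) :=
          div_le_self (by positivity) (by exact_mod_cast Nat.factorial_pos _)
      _ = x * x ^ k := pow_succ' x k
      _ ≤ x * (1 / 4) ^ k := by gcongr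
  rw [tsum_mul_left, tsum_mul_left, tsum_geometric_of_lt_one (by norm_num) (by norm_num)] at htail
  intro h0
  rw [besselEntire, hsum.tsum_eq_zero_add] at h0
  have hfirst : (-1 : ℝ) ^ 0 / ((Nat.factorial 0) * Gamma ((0 : ℕ) + μ + 1)) * (s / 4) ^ 0 =
      (Gamma (μ + 1))⁻¹ := by simp
  rw [hfirst] at h0
  have htail' := (neg_abs_le _).trans' (neg_le_neg (Real.norm_eq_abs _ ▸ htail))
  have hGi : 0 < (Gamma (μ + 1))⁻¹ := by positivity
  nlinarith

lemma besselEntire_ne_zero_or {μ s : ℝ} (hμ : 0 ≤ μ) (hs : 0 < s) :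
    besselEntire μ s ≠ 0 ∨ besselEntire (μ + 1) s ≠ 0 := by
  by_contra! h
  have hall : ∀ m : ℕ, besselEntire (μ + m) s = 0 ∧ besselEntire (μ + m + 1) s = 0 := by
    intro m
    induction m with
    | zero => simpa using h
    | succ m ih =>
      have hrec := besselEntire_recurrence (μ := μ + m) (by positivity) s
      rw [ih.1, ih.2, mul_zero, zero_sub, eq_comm, neg_eq_zero, mul_eq_zero] at hrec
      push_cast
      refine ⟨by rw [← add_assoc]; exact ih.2, ?_⟩
      rw [show μ + (m + 1) + 1 = μ + m + 2 by ring]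
      exact hrec.resolve_left (by positivity)
  obtain ⟨m, hm⟩ := exists_nat_ge s
  refine besselEntire_ne_zero_of_le (μ := μ + m) (by positivity) ?_ (hall m).1
  rw [abs_of_pos hs]
  linarith

lemma besselJ_div_rpow {μ r : ℝ} (hr : 0 < r) :
    besselJ μ r / r ^ μ = (2 ^ μ)⁻¹ * besselEntire μ (r ^ 2) := by
  have hrμ : r ^ μ ≠ 0 := (rpow_pos_of_pos hr μ).ne'
  rw [div_eq_iff hrμ, besselJ, besselEntire, ← tsum_mul_left, ← tsum_mul_right]
  refine tsum_congr fun k => ?_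
  have : (r / 2) ^ (2 * (k : ℝ) + μ) = (r ^ 2 / 4) ^ k * ((2 ^ μ)⁻¹ * r ^ μ) := by
    rw [rpow_add (by positivity), rpow_mul (by positivity), rpow_natCast,
      div_rpow hr.le zero_le_two μ, div_eq_inv_mul (r ^ μ), rpow_two, div_pow]
    norm_num
  rw [this]
  ring

/-! ### Integration over the unit sphere -/

section Sphere

variable {E : Type*} [NormedAddCommGroup E] [MeasurableSpace E] [BorelSpace E]

/-- Integration in polar coordinates. -/
lemma integral_eq_integral_Ioi_integral_toSphere [NormedSpace ℝ E] [FiniteDimensional ℝ E]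
    [Nontrivial E] (μ : Measure E) [μ.IsAddHaarMeasure] {H : E → ℝ} (hH : Integrable H μ) :
    ∫ x, H x ∂μ = ∫ t in Set.Ioi (0 : ℝ), t ^ (Module.finrank ℝ E - 1) *
      ∫ η : Metric.sphere (0 : E) 1, H (t • (η : E)) ∂μ.toSphere := by
  set d := Module.finrank ℝ E - 1
  have hmp := μ.measurePreserving_homeomorphUnitSphereProd
  have hemb := (homeomorphUnitSphereProd E).measurableEmbedding
  let g : Metric.sphere (0 : E) 1 × Set.Ioi (0 : ℝ) → ℝ := fun p => H ((p.2 : ℝ) • (p.1 : E))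
  have hg : ∀ x : ({0}ᶜ : Set E), g (homeomorphUnitSphereProd E x) = H x := by
    intro x
    have h := homeomorphUnitSphereProd_symm_apply_coe E (homeomorphUnitSphereProd E x)
    rw [Homeomorph.symm_apply_apply] at h
    simp only [g]
    rw [← h]
  have hint : Integrable g (μ.toSphere.prod (.volumeIoiPow d)) := by
    rw [← hmp.integrable_comp_emb hemb]
    have : (g ∘ homeomorphUnitSphereProd E) = fun x : ({0}ᶜ : Set E) => H x := funext hg
    rw [this]
    exact (integrableOn_iff_comap_subtypeVal (measurableSet_singleton _).compl).1 hH.integrableOn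
  calc ∫ x, H x ∂μ = ∫ x : ({(0)}ᶜ : Set E), H x.1 ∂(μ.comap (↑)) := by
        rw [integral_subtype_comap (measurableSet_singleton _).compl H, restrict_compl_singleton]
    _ = ∫ p, g p ∂(μ.toSphere.prod (.volumeIoiPow d)) := by
        rw [← hmp.integral_comp hemb]
        simp_rw [hg]
    _ = ∫ t : Set.Ioi (0 : ℝ), ∫ η : Metric.sphere (0 : E) 1, g (η, t) ∂μ.toSphere
          ∂.volumeIoiPow d := integral_prod_symm _ hint
    _ = _ := by
        simp only [Measure.volumeIoiPow, ENNReal.ofReal]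
        rw [integral_withDensity_eq_integral_smul,
          integral_subtype_comap measurableSet_Ioi fun a : ℝ => Real.toNNReal (a ^ d) •
            ∫ η : Metric.sphere (0 : E) 1, H (a • (η : E)) ∂μ.toSphere,
          setIntegral_congr_fun measurableSet_Ioi fun x hx => ?_]
        · rw [NNReal.smul_def, Real.coe_toNNReal _ (pow_nonneg hx.out.le _), smul_eq_mul]
        · exact (measurable_subtype_coe.pow_const _).real_toNNReal

open scoped Pointwise in
/-- The surface measure of the unit sphere is invariant under linear isometries. -/
lemma measurePreserving_toSphere [InnerProductSpace ℝ E] [FiniteDimensional ℝ E] (A : E ≃ₗᵢ[ℝ] E)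
    (T : Metric.sphere (0 : E) 1 → Metric.sphere (0 : E) 1) (hT : ∀ η, (T η : E) = A η) :
    MeasurePreserving T (volume : Measure E).toSphere (volume : Measure E).toSphere := by
  have hTc : Continuous T := by
    rw [continuous_induced_rng]
    exact (A.continuous.comp continuous_subtype_val).congr fun η => (hT η).symm
  refine ⟨hTc.measurable, Measure.ext fun s hs => ?_⟩
  rw [Measure.map_apply hTc.measurable hs, Measure.toSphere_apply' _ hs,
    Measure.toSphere_apply' _ (hTc.measurable hs)]
  congr 1
  rw [← A.measurePreserving.measure_preimage_emb A.toHomeomorph.measurableEmbedding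
    (Set.Ioo (0 : ℝ) 1 • (Subtype.val '' s))]
  congr 1
  ext x
  simp only [Set.mem_smul, Set.mem_image, Set.mem_preimage]
  constructor
  · rintro ⟨t, ht, _, ⟨η, hη, rfl⟩, rfl⟩
    exact ⟨t, ht, _, ⟨T η, hη, rfl⟩, by rw [hT, map_smul]⟩
  · rintro ⟨t, ht, _, ⟨η, hη, rfl⟩, hx⟩
    have hmem : A.symm (η : E) ∈ Metric.sphere (0 : E) 1 := by simp
    refine ⟨t, ht, _, ⟨⟨A.symm η, hmem⟩, ?_, rfl⟩, ?_⟩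
    · rwa [show T ⟨A.symm η, hmem⟩ = η from Subtype.ext (by simp [hT])]
    · apply A.injective
      simp [hx]

lemma integral_toSphere_inner_eq [InnerProductSpace ℝ E] [FiniteDimensional ℝ E]
    {κ : ℝ → ℝ} (hκ : Continuous κ) (ω ω' : Metric.sphere (0 : E) 1) :
    ∫ η : Metric.sphere (0 : E) 1, κ (inner ℝ (ω : E) η) ∂(volume : Measure E).toSphere =
      ∫ η : Metric.sphere (0 : E) 1, κ (inner ℝ (ω' : E) η) ∂(volume : Measure E).toSphere := by
  have hnorm : ‖(ω : E)‖ = ‖(ω' : E)‖ := by simp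
  let A : E ≃ₗᵢ[ℝ] E := (ℝ ∙ ((ω : E) - ω'))ᗮ.reflection
  have hA : A ω = ω' := Submodule.reflection_sub hnorm
  let T : Metric.sphere (0 : E) 1 → Metric.sphere (0 : E) 1 := fun η => ⟨A η, by simp⟩
  have hT := measurePreserving_toSphere A T fun _ => rfl
  have hc : Continuous fun η : Metric.sphere (0 : E) 1 => κ (inner ℝ (ω' : E) η) := by fun_prop
  rw [← hT.map_eq, integral_map hT.measurable.aemeasurable
    (hc.aestronglyMeasurable), hT.map_eq]
  refine integral_congr_ae (Filter.Eventually.of_forall fun η => ?_)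
  simp only [T]
  rw [← hA, A.inner_map_map]

end Sphere

/-- Differentiation under the integral sign over a compact space. -/
lemma hasDerivAt_integral_of_continuous {α : Type*} [TopologicalSpace α] [CompactSpace α]
    [MeasurableSpace α] [OpensMeasurableSpace α] (μ : Measure α) [IsFiniteMeasure μ]
    {F F' : ℝ → α → ℝ} (hF : Continuous F.uncurry) (hF' : Continuous F'.uncurry)
    (h : ∀ t a, HasDerivAt (F · a) (F' t a) t) (t : ℝ) :
    HasDerivAt (fun t => ∫ a, F t a ∂μ) (∫ a, F' t a ∂μ) t := by
  obtain ⟨C, hC⟩ := ((isCompact_closedBall t 1).prod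
    (isCompact_univ (X := α))).exists_bound_of_continuousOn hF'.continuousOn
  have hFt : ∀ t, Continuous (F t) := fun t => hF.comp (by fun_prop : Continuous fun a => (t, a))
  have hFt' : ∀ t, Continuous (F' t) := fun t => hF'.comp (by fun_prop : Continuous fun a => (t, a))
  refine (hasDerivAt_integral_of_dominated_loc_of_deriv_le (bound := fun _ => C)
    (Metric.closedBall_mem_nhds t one_pos)
    (Filter.Eventually.of_forall fun s => (hFt s).aestronglyMeasurable)
    ?_ (hFt' t).aestronglyMeasurable ?_ (integrable_const _)
    (Filter.Eventually.of_forall fun a s _ => h s a)).2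
  · exact (hFt t).integrable_of_hasCompactSupport (HasCompactSupport.of_compactSpace _)
  · exact Filter.Eventually.of_forall fun a s hs => hC (s, a) ⟨hs, Set.mem_univ _⟩

/-! ### Green's formula and the radial Wronskian -/

lemma apply_eq_sum_single {n : ℕ} (L : EuclideanSpace ℝ (Fin n) →L[ℝ] ℝ)
    (x : EuclideanSpace ℝ (Fin n)) : L x = ∑ i, x i * L (EuclideanSpace.single i 1) := by
  conv_lhs => rw [← (EuclideanSpace.basisFun (Fin n) ℝ).sum_repr x]
  simp

lemma integral_radial_mul_wronskian_eq_zero {n : ℕ} {r : ℝ}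
    {f V : EuclideanSpace ℝ (Fin n) → ℝ}
    (hf : ContDiff ℝ (⊤ : ℕ∞) f) (hV : ContDiff ℝ (⊤ : ℕ∞) V)
    (hfeq : ∀ x ∈ Metric.ball (0 : EuclideanSpace ℝ (Fin n)) r, laplacian f x + f x = 0)
    (hVeq : ∀ x, laplacian V x + V x = 0) {θ : ℝ → ℝ} (hθ : ContDiff ℝ (⊤ : ℕ∞) θ) {ρ : ℝ}
    (hρ0 : 0 < ρ) (hρ : ρ < r) (hθρ : ∀ s, ρ ^ 2 ≤ s → θ s = 0) :
    ∫ x, θ (‖x‖ ^ 2) * (f x * fderiv ℝ V x x - V x * fderiv ℝ f x x) = 0 := by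
  set e : Fin n → EuclideanSpace ℝ (Fin n) := fun i => EuclideanSpace.single i 1
  set ψ : ℝ → ℝ := fun s => ∫ t in (ρ ^ 2)..s, θ t with hψdef
  have hψ' : ∀ s, HasDerivAt ψ (θ s) s := fun s =>
    hθ.continuous.integral_hasStrictDerivAt _ _ |>.hasDerivAt
  have hψ : ContDiff ℝ (⊤ : ℕ∞) ψ := by
    rw [contDiff_infty_iff_deriv]
    refine ⟨fun s => (hψ' s).differentiableAt, ?_⟩
    rwa [funext fun s => (hψ' s).deriv]
  have hψ0 : ∀ s, ρ ^ 2 ≤ s → ψ s = 0 := by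
    intro s hs
    refine intervalIntegral.integral_zero_ae (Filter.Eventually.of_forall fun t ht => hθρ t ?_)
    rw [Set.uIoc_of_le hs] at ht
    exact ht.1.le
  set χ : EuclideanSpace ℝ (Fin n) → ℝ := fun x => ψ (‖x‖ ^ 2) with hχdef
  have hχ : ContDiff ℝ (⊤ : ℕ∞) χ := hψ.comp (contDiff_norm_sq ℝ)
  have hχ0 : ∀ x, x ∉ Metric.closedBall (0 : EuclideanSpace ℝ (Fin n)) ρ → χ x = 0 := by
    intro x hx
    rw [mem_closedBall_zero_iff, not_le] at hx
    exact hψ0 _ (by gcongr)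
  have hχs : HasCompactSupport χ :=
    HasCompactSupport.intro (isCompact_closedBall _ _) hχ0
  have hχd : ∀ x i, fderiv ℝ χ x (e i) = 2 * θ (‖x‖ ^ 2) * x i := by
    intro x i
    have h1 : HasFDerivAt (fun x : EuclideanSpace ℝ (Fin n) => ‖x‖ ^ 2) (2 • innerSL ℝ x) x :=
      (hasStrictFDerivAt_norm_sq x).hasFDerivAt
    have h2 := (hψ' (‖x‖ ^ 2)).comp_hasFDerivAt x h1
    rw [show χ = ψ ∘ fun x => ‖x‖ ^ 2 from rfl, h2.fderiv]
    simp [e, EuclideanSpace.inner_single_right]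
    ring
  have hfd : ∀ {g : EuclideanSpace ℝ (Fin n) → ℝ} (_ : ContDiff ℝ (⊤ : ℕ∞) g) (i : Fin n),
      ContDiff ℝ (⊤ : ℕ∞) fun y => fderiv ℝ g y (e i) := fun hg i =>
    (hg.fderiv_right (m := (⊤ : ℕ∞)) (by simp)).clm_apply contDiff_const
  set w : Fin n → EuclideanSpace ℝ (Fin n) → ℝ := fun i x =>
    f x * fderiv ℝ V x (e i) - V x * fderiv ℝ f x (e i) with hwdef
  have hw : ∀ i, ContDiff ℝ (⊤ : ℕ∞) (w i) := fun i =>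
    (hf.mul (hfd hV i)).sub (hV.mul (hfd hf i))
  have hwd : ∀ x, ∑ i, fderiv ℝ (w i) x (e i) = f x * laplacian V x - V x * laplacian f x := by
    intro x
    have hdiff : ∀ {g : EuclideanSpace ℝ (Fin n) → ℝ}, ContDiff ℝ (⊤ : ℕ∞) g →
        DifferentiableAt ℝ g x := fun hg => hg.differentiable (by simp) x
    have hi : ∀ i, fderiv ℝ (w i) x (e i) =
        f x * fderiv ℝ (fun y => fderiv ℝ V y (e i)) x (e i) -
        V x * fderiv ℝ (fun y => fderiv ℝ f y (e i)) x (e i) := by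
      intro i
      have h1 := ((hdiff hf).hasFDerivAt.mul (hdiff (hfd hV i)).hasFDerivAt).sub
        ((hdiff hV).hasFDerivAt.mul (hdiff (hfd hf i)).hasFDerivAt)
      have h2 : HasFDerivAt (w i) _ x := h1
      rw [h2.fderiv]
      simp
      ring
    simp_rw [hi, Finset.sum_sub_distrib, ← Finset.mul_sum]
    rfl
  have hparts : ∀ i, ∫ x, w i x * fderiv ℝ χ x (e i) = -∫ x, fderiv ℝ (w i) x (e i) * χ x := by
    intro i
    refine integral_mul_fderiv_eq_neg_fderiv_mul_of_integrable ?_ ?_ ?_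
      (fun x _ => (hw i).differentiable (by simp) x) (fun x _ => hχ.differentiable (by simp) x)
    · exact ((hfd (hw i) i).continuous.mul hχ.continuous).integrable_of_hasCompactSupport
        hχs.mul_left
    · exact ((hw i).continuous.mul (hfd hχ i).continuous).integrable_of_hasCompactSupport
        (hχs.fderiv_apply (𝕜 := ℝ) (e i)).mul_left
    · exact ((hw i).continuous.mul hχ.continuous).integrable_of_hasCompactSupport
        hχs.mul_left
  have hsum : ∫ x, ∑ i, w i x * fderiv ℝ χ x (e i) = 0 := by
    rw [integral_finsetSum]
    · simp_rw [hparts]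
      rw [Finset.sum_neg_distrib, ← integral_finsetSum, neg_eq_zero]
      · refine (integral_congr_ae (Filter.Eventually.of_forall fun x => ?_)).trans (integral_zero' _ _)
        simp only [Pi.zero_apply]
        rw [← Finset.sum_mul, hwd]
        by_cases hx : x ∈ Metric.closedBall (0 : EuclideanSpace ℝ (Fin n)) ρ
        · have h1 := hfeq x (Metric.closedBall_subset_ball hρ hx)
          rw [eq_neg_of_add_eq_zero_left h1, eq_neg_of_add_eq_zero_left (hVeq x)]
          ring
        · rw [hχ0 x hx, mul_zero]
      · exact fun i _ => ((hfd (hw i) i).continuous.mul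
          hχ.continuous).integrable_of_hasCompactSupport hχs.mul_left
    · exact fun i _ => ((hw i).continuous.mul (hfd hχ i).continuous).integrable_of_hasCompactSupport
        (hχs.fderiv_apply (𝕜 := ℝ) (e i)).mul_left
  have hpt : ∀ x, ∑ i, w i x * fderiv ℝ χ x (e i) =
      2 * (θ (‖x‖ ^ 2) * (f x * fderiv ℝ V x x - V x * fderiv ℝ f x x)) := by
    intro x
    rw [apply_eq_sum_single (fderiv ℝ V x) x, apply_eq_sum_single (fderiv ℝ f x) x,
      Finset.mul_sum, Finset.mul_sum, ← Finset.sum_sub_distrib, Finset.mul_sum, Finset.mul_sum]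
    refine Finset.sum_congr rfl fun i _ => ?_
    rw [hχd]
    simp only [w, e]
    ring
  simp_rw [hpt] at hsum
  rw [integral_const_mul] at hsum
  exact (mul_eq_zero.1 hsum).resolve_left two_ne_zero

lemma integral_toSphere_wronskian_eq_zero {n : ℕ} (hn : 2 ≤ n) {r : ℝ}
    {f V : EuclideanSpace ℝ (Fin n) → ℝ}
    (hf : ContDiff ℝ (⊤ : ℕ∞) f) (hV : ContDiff ℝ (⊤ : ℕ∞) V)
    (hfeq : ∀ x ∈ Metric.ball (0 : EuclideanSpace ℝ (Fin n)) r, laplacian f x + f x = 0)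
    (hVeq : ∀ x, laplacian V x + V x = 0) {t : ℝ} (ht : t ∈ Set.Ioo 0 r) :
    ∫ η : Metric.sphere (0 : EuclideanSpace ℝ (Fin n)) 1,
      (f (t • (η : EuclideanSpace ℝ (Fin n))) * fderiv ℝ V (t • (η : EuclideanSpace ℝ (Fin n)))
          (t • (η : EuclideanSpace ℝ (Fin n))) -
        V (t • (η : EuclideanSpace ℝ (Fin n))) * fderiv ℝ f (t • (η : EuclideanSpace ℝ (Fin n)))
          (t • (η : EuclideanSpace ℝ (Fin n))))
      ∂(volume : Measure (EuclideanSpace ℝ (Fin n))).toSphere = 0 := by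
  have : Nontrivial (EuclideanSpace ℝ (Fin n)) := by
    have : Nonempty (Fin n) := ⟨⟨0, by omega⟩⟩
    infer_instance
  set G : EuclideanSpace ℝ (Fin n) → ℝ := fun x => f x * fderiv ℝ V x x - V x * fderiv ℝ f x x
    with hG
  have hGc : Continuous G :=
    (hf.continuous.mul ((hV.continuous_fderiv (by simp)).clm_apply continuous_id)).sub
      (hV.continuous.mul ((hf.continuous_fderiv (by simp)).clm_apply continuous_id))
  set M : ℝ → ℝ := fun t => ∫ η : Metric.sphere (0 : EuclideanSpace ℝ (Fin n)) 1,
    G (t • (η : EuclideanSpace ℝ (Fin n))) ∂(volume : Measure (EuclideanSpace ℝ (Fin n))).toSphere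
    with hM
  have hMc : Continuous M := by
    have h := continuous_parametric_integral_of_continuous
      (μ := (volume : Measure (EuclideanSpace ℝ (Fin n))).toSphere)
      (f := fun (t : ℝ) (η : Metric.sphere (0 : EuclideanSpace ℝ (Fin n)) 1) =>
        G (t • (η : EuclideanSpace ℝ (Fin n)))) (by
          unfold Function.uncurry; fun_prop) isCompact_univ
    simpa using h
  set d := n - 1
  have hae : ∀ᵐ t : ℝ, t ∈ Set.Ioo 0 r → t ^ d * M t = 0 := by
    refine isOpen_Ioo.ae_eq_zero_of_integral_contDiff_smul_eq_zero
      ((by fun_prop : Continuous fun t => t ^ d * M t).locallyIntegrable.locallyIntegrableOn _) ?_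
    intro φ hφ hφc hφs
    obtain ⟨δ, hδ0, hδ⟩ := IsCompact.exists_forall_le' (s := tsupport φ) hφc continuousOn_id
      (a := 0) fun b hb => (hφs hb).1
    obtain ⟨ρ, hρr, hρ⟩ := IsCompact.exists_forall_le' (s := tsupport φ) hφc
      continuous_neg.continuousOn (a := -r) fun b hb => neg_lt_neg (hφs hb).2
    have hφδ : ∀ t < δ, φ t = 0 := fun t ht =>
      image_eq_zero_of_notMem_tsupport fun h => absurd (hδ t h) (not_le.2 ht)
    have hφρ : ∀ t, -ρ < t → φ t = 0 := fun t ht =>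
      image_eq_zero_of_notMem_tsupport fun h => absurd (hρ t h) (by linarith)
    set ρ' := (max (-ρ) 0 + r) / 2
    have hr : 0 < r := ht.1.trans ht.2
    have hmax : max (-ρ) 0 < r := max_lt (by linarith) hr
    have hρ'0 : 0 < ρ' := by have := le_max_right (-ρ) 0; simp only [ρ']; linarith
    have hρ'r : ρ' < r := by simp only [ρ']; linarith
    have hρρ' : -ρ < ρ' := by have := le_max_left (-ρ) 0; simp only [ρ']; linarith
    set θ : ℝ → ℝ := fun s => φ (√s) with hθdef
    have hθ : ContDiff ℝ (⊤ : ℕ∞) θ := by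
      rw [contDiff_iff_contDiffAt]
      intro s
      by_cases hs : 0 < s
      · exact (hφ.contDiffAt (x := √s)).comp s (contDiffAt_sqrt hs.ne')
      · have h0 : θ =ᶠ[nhds s] fun _ => 0 := by
          have : ∀ᶠ y in nhds s, √y < δ :=
            continuous_sqrt.continuousAt.eventually_lt_const
              ((sqrt_eq_zero_of_nonpos (not_lt.1 hs)).trans_lt hδ0)
          filter_upwards [this] with y hy using hφδ _ hy
        exact contDiffAt_const.congr_of_eventuallyEq h0
    have hθρ : ∀ s, ρ' ^ 2 ≤ s → θ s = 0 := fun s hs =>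
      hφρ _ (hρρ'.trans_le (le_sqrt_of_sq_le hs))
    have h0 := integral_radial_mul_wronskian_eq_zero hf hV hfeq hVeq hθ hρ'0 hρ'r hθρ
    rw [integral_eq_integral_Ioi_integral_toSphere] at h0
    · rw [← h0, ← setIntegral_eq_integral_of_forall_compl_eq_zero (s := Set.Ioi 0)]
      · refine setIntegral_congr_fun measurableSet_Ioi fun t ht => ?_
        have ht' : (0 : ℝ) < t := ht
        have hnorm : ∀ η : Metric.sphere (0 : EuclideanSpace ℝ (Fin n)) 1,
            θ (‖t • (η : EuclideanSpace ℝ (Fin n))‖ ^ 2) = φ t := by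
          intro η
          simp [hθdef, norm_smul, abs_of_pos ht', sqrt_sq ht'.le]
        simp only [hnorm, integral_const_mul, smul_eq_mul, finrank_euclideanSpace, Fintype.card_fin]
        simp only [hM, hG, d]
        ring
      · intro t ht
        rw [hφδ t (lt_of_le_of_lt (not_lt.1 ht) hδ0), zero_smul]
    · refine (((hθ.continuous.comp (continuous_norm.pow 2))).mul
        hGc).integrable_of_hasCompactSupport (HasCompactSupport.intro (isCompact_closedBall 0 ρ') ?_)
      intro x hx
      rw [mem_closedBall_zero_iff, not_le] at hx
      simp only [Pi.mul_apply, Function.comp_apply, Pi.pow_apply]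
      rw [hθρ _ (by gcongr), zero_mul]
  have hEq : Set.EqOn (fun t => t ^ d * M t) (fun _ => 0) (Set.Ioo 0 r) :=
    Measure.eqOn_open_of_ae_eq (μ := volume)
      ((ae_restrict_iff' measurableSet_Ioo).2 hae) isOpen_Ioo
      (by fun_prop) (by fun_prop)
  exact (mul_eq_zero.1 (hEq ht)).resolve_left (pow_ne_zero _ ht.1.ne')

/-! ### Separated solutions of the Helmholtz equation -/

lemma hasFDerivAt_eval {n : ℕ} (P : MvPolynomial (Fin n) ℝ) (x : EuclideanSpace ℝ (Fin n)) :
    HasFDerivAt (fun x : EuclideanSpace ℝ (Fin n) => MvPolynomial.eval (fun i => x i) P)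
      (∑ i, MvPolynomial.eval (fun i => x i) (MvPolynomial.pderiv i P) •
        (EuclideanSpace.proj i : EuclideanSpace ℝ (Fin n) →L[ℝ] ℝ)) x := by
  induction P using MvPolynomial.induction_on with
  | C a => simpa using hasFDerivAt_const a x
  | add p q hp hq =>
    simp only [map_add, add_smul, Finset.sum_add_distrib]
    exact hp.add hq
  | mul_X p j hp =>
    simp only [map_mul, MvPolynomial.eval_X]
    refine (hp.mul (EuclideanSpace.proj j :
      EuclideanSpace ℝ (Fin n) →L[ℝ] ℝ).hasFDerivAt).congr_fderiv ?_
    ext v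
    simp [MvPolynomial.pderiv_X, Pi.single_apply, add_mul,
      Finset.sum_add_distrib, Finset.mul_sum, apply_ite]
    exact Finset.sum_congr rfl fun i _ => by ring

lemma contDiff_eval {n : ℕ} (P : MvPolynomial (Fin n) ℝ) :
    ContDiff ℝ (⊤ : ℕ∞)
      fun x : EuclideanSpace ℝ (Fin n) => MvPolynomial.eval (fun i => x i) P := by
  induction P using MvPolynomial.induction_on with
  | C a => simpa using contDiff_const
  | add p q hp hq => simpa using hp.add hq
  | mul_X p j hp =>
    simp only [map_mul, MvPolynomial.eval_X]
    exact hp.mul (EuclideanSpace.proj j : EuclideanSpace ℝ (Fin n) →L[ℝ] ℝ).contDiff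

/-- The function `x ↦ P(x) J_μ(|x|) / |x|^μ`, up to normalization. -/
def polyMulBessel {n : ℕ} (μ : ℝ) (P : MvPolynomial (Fin n) ℝ) (x : EuclideanSpace ℝ (Fin n)) : ℝ :=
  MvPolynomial.eval (fun i => x i) P * besselEntire μ (‖x‖ ^ 2)

lemma contDiff_polyMulBessel {n : ℕ} {μ : ℝ} (hμ : 0 ≤ μ) (P : MvPolynomial (Fin n) ℝ) :
    ContDiff ℝ (⊤ : ℕ∞) (polyMulBessel μ P) :=
  (contDiff_eval P).mul ((contDiff_besselEntire hμ).comp (contDiff_norm_sq ℝ))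

lemma fderiv_polyMulBessel_single {n : ℕ} {μ : ℝ} (hμ : 0 ≤ μ) (P : MvPolynomial (Fin n) ℝ)
    (i : Fin n) (x : EuclideanSpace ℝ (Fin n)) :
    fderiv ℝ (polyMulBessel μ P) x (EuclideanSpace.single i 1) =
      polyMulBessel μ (MvPolynomial.pderiv i P) x +
        polyMulBessel (μ + 1) (MvPolynomial.C (-1 / 2) * (MvPolynomial.X i * P)) x := by
  have h1 : HasFDerivAt (fun x : EuclideanSpace ℝ (Fin n) => ‖x‖ ^ 2) (2 • innerSL ℝ x) x :=
    (hasStrictFDerivAt_norm_sq x).hasFDerivAt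
  have h2 : HasFDerivAt (polyMulBessel μ P) _ x :=
    (hasFDerivAt_eval P x).mul ((hasDerivAt_besselEntire hμ _).comp_hasFDerivAt x h1)
  rw [h2.fderiv]
  simp [polyMulBessel, EuclideanSpace.inner_single_right]
  ring

lemma laplacian_polyMulBessel_add_self {n ℓ : ℕ} {μ : ℝ} (hμ : 0 ≤ μ)
    (hℓ : μ + 1 = ℓ + (n : ℝ) / 2) {P : MvPolynomial (Fin n) ℝ} (hP : P.IsHomogeneous ℓ)
    (hΔ : polyLaplacian P = 0) (x : EuclideanSpace ℝ (Fin n)) :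
    laplacian (polyMulBessel μ P) x + polyMulBessel μ P x = 0 := by
  have hd : ∀ {μ : ℝ} (_ : 0 ≤ μ) (P : MvPolynomial (Fin n) ℝ),
      DifferentiableAt ℝ (polyMulBessel μ P) x := fun hμ P =>
    (contDiff_polyMulBessel hμ P).differentiable (by simp) x
  have hμ1 : 0 ≤ μ + 1 := by linarith
  have hterm : ∀ i : Fin n, fderiv ℝ (fun y => fderiv ℝ (polyMulBessel μ P) y
      (EuclideanSpace.single i 1)) x (EuclideanSpace.single i 1) =
      MvPolynomial.eval (fun i => x i) (MvPolynomial.pderiv i (MvPolynomial.pderiv i P)) *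
        besselEntire μ (‖x‖ ^ 2) -
      MvPolynomial.eval (fun i => x i) (MvPolynomial.X i * MvPolynomial.pderiv i P) *
        besselEntire (μ + 1) (‖x‖ ^ 2) -
      1 / 2 * (MvPolynomial.eval (fun i => x i) P * besselEntire (μ + 1) (‖x‖ ^ 2)) +
      x i ^ 2 * (MvPolynomial.eval (fun i => x i) P * besselEntire (μ + 2) (‖x‖ ^ 2) / 4) := by
    intro i
    simp_rw [fderiv_polyMulBessel_single hμ P i]
    rw [fderiv_fun_add (hd hμ _) (hd hμ1 _), add_apply,
      fderiv_polyMulBessel_single hμ, fderiv_polyMulBessel_single hμ1,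
      show μ + 1 + 1 = μ + 2 by ring]
    simp [polyMulBessel]
    ring
  have hΔ' : ∑ i, MvPolynomial.eval (fun i => x i)
      (MvPolynomial.pderiv i (MvPolynomial.pderiv i P)) = 0 := by
    rw [← map_sum]
    exact (congrArg _ hΔ).trans (map_zero _)
  have hE : ∑ i, MvPolynomial.eval (fun i => x i) (MvPolynomial.X i * MvPolynomial.pderiv i P) =
      ℓ * MvPolynomial.eval (fun i => x i) P := by
    rw [← map_sum, hP.sum_X_mul_pderiv]
    simp
  have hx : ∑ i, x i ^ 2 = ‖x‖ ^ 2 := (EuclideanSpace.real_norm_sq_eq x).symm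
  unfold laplacian
  simp_rw [hterm]
  rw [Finset.sum_add_distrib, Finset.sum_sub_distrib, Finset.sum_sub_distrib, ← Finset.sum_mul,
    ← Finset.sum_mul, ← Finset.sum_mul, ← Finset.sum_mul, hΔ', hE, hx, Finset.sum_const, polyMulBessel,
    besselEntire_recurrence hμ, Finset.card_univ, Fintype.card_fin, nsmul_eq_mul]
  linear_combination (MvPolynomial.eval (fun i => x i) P * besselEntire (μ + 1) (‖x‖ ^ 2)) * hℓ

/-! ### Proportionality of functions with vanishing Wronskian -/

lemma hasDerivAt_zero_of_eventually_nhdsNE {c : ℝ → ℝ} {t : ℝ} (hc : ContinuousAt c t)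
    (h : ∀ᶠ y in nhdsWithin t {t}ᶜ, HasDerivAt c 0 y) : HasDerivAt c 0 t := by
  have key : ∀ s : Set ℝ, s ⊆ {t}ᶜ → ∃ v ∈ nhdsWithin t s, DifferentiableOn ℝ c v ∧
      Filter.Tendsto (deriv c) (nhdsWithin t s) (nhds 0) := by
    intro s hs
    have h' := h.filter_mono (nhdsWithin_mono t hs)
    refine ⟨_, h', fun y hy => (hy : HasDerivAt c 0 y).differentiableAt.differentiableWithinAt,
      tendsto_const_nhds.congr' ?_⟩
    filter_upwards [h'] with y hy using hy.deriv.symm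
  obtain ⟨v, hv, hd, hl⟩ := key (Set.Ioi t) fun y hy => ne_of_gt hy
  obtain ⟨v', hv', hd', hl'⟩ := key (Set.Iio t) fun y hy => ne_of_lt hy
  have := (hasDerivWithinAt_Ici_of_tendsto_deriv hd hc.continuousWithinAt hv hl).union
    (hasDerivWithinAt_Iic_of_tendsto_deriv hd' hc.continuousWithinAt hv' hl')
  rwa [Set.union_comm, Set.Iic_union_Ici, hasDerivWithinAt_univ] at this

lemma exists_eq_const_mul_of_wronskian_eq_zero {r : ℝ} {u u' a a' : ℝ → ℝ}
    (hu : ∀ t, HasDerivAt u (u' t) t) (ha : ∀ t, HasDerivAt a (a' t) t)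
    (hu' : Continuous u') (ha' : Continuous a')
    (hw : ∀ t ∈ Set.Ioo 0 r, a t * u' t = u t * a' t)
    (hne : ∀ t ∈ Set.Ioo 0 r, u t ≠ 0 ∨ u' t ≠ 0) :
    ∃ C, ∀ t ∈ Set.Ioo 0 r, a t = C * u t := by
  set c : ℝ → ℝ := fun t => (a t * u t + a' t * u' t) / (u t ^ 2 + u' t ^ 2) with hc
  have hpos : ∀ t ∈ Set.Ioo 0 r, u t ^ 2 + u' t ^ 2 ≠ 0 := by
    intro t ht
    rcases hne t ht with h | h <;> positivity
  have hac : ∀ t ∈ Set.Ioo 0 r, a t = c t * u t := by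
    intro t ht
    have := hpos t ht
    simp only [hc]
    field_simp
    linear_combination u' t * hw t ht
  have huc : Continuous u := continuous_iff_continuousAt.2 fun t => (hu t).continuousAt
  have hac' : Continuous a := continuous_iff_continuousAt.2 fun t => (ha t).continuousAt
  have hcc : ∀ t ∈ Set.Ioo 0 r, ContinuousAt c t := fun t ht =>
    ((by fun_prop : Continuous fun t => a t * u t + a' t * u' t).continuousAt).div
      ((by fun_prop : Continuous fun t => u t ^ 2 + u' t ^ 2).continuousAt) (hpos t ht)
  have hder : ∀ t ∈ Set.Ioo 0 r, u t ≠ 0 → HasDerivAt c 0 t := by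
    intro t ht h0
    have h1 := ((ha t).div (hu t) h0)
    rw [show a' t * u t - a t * u' t = 0 by rw [hw t ht]; ring, zero_div] at h1
    refine h1.congr_of_eventuallyEq ?_
    filter_upwards [isOpen_Ioo.mem_nhds ht, huc.continuousAt.eventually_ne h0] with y hy hy0
    rw [Pi.div_apply, hac y hy, mul_div_cancel_right₀ _ hy0]
  have hder' : ∀ t ∈ Set.Ioo 0 r, HasDerivAt c 0 t := by
    intro t ht
    by_cases h0 : u t = 0
    · refine hasDerivAt_zero_of_eventually_nhdsNE (hcc t ht) ?_
      have h1 := (hne t ht).resolve_left (not_not.2 h0)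
      filter_upwards [(hu t).eventually_ne (c := 0) h1,
        mem_nhdsWithin_of_mem_nhds (isOpen_Ioo.mem_nhds ht)] with y hy hy'
      exact hder y hy' hy
    · exact hder t ht h0
  obtain ⟨C, hC⟩ := isOpen_Ioo.exists_is_const_of_deriv_eq_zero isPreconnected_Ioo
    (fun t ht => (hder' t ht).differentiableAt.differentiableWithinAt)
    (fun t ht => (hder' t ht).deriv)
  exact ⟨C, fun t ht => by rw [hac t ht, hC t ht]⟩

/-! ### Spherical harmonic coefficients of a solution -/

/-- The unit sphere of `ℝ^n`. -/
abbrev UnitSphere (n : ℕ) := Metric.sphere (0 : EuclideanSpace ℝ (Fin n)) 1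

/-- The surface measure of the unit sphere of `ℝ^n`. -/
abbrev surfaceMeasure (n : ℕ) : Measure (UnitSphere n) :=
  (volume : Measure (EuclideanSpace ℝ (Fin n))).toSphere

lemma sum_eq_of_isHomogeneous {n ℓ : ℕ} {P : MvPolynomial (Fin n) ℝ} (hP : P.IsHomogeneous ℓ)
    {d : Fin n →₀ ℕ} (hd : d ∈ P.support) : ∑ i, d i = ℓ := by
  rw [← hP (MvPolynomial.mem_support_iff.1 hd), Finsupp.weight_apply,
    Finsupp.sum_fintype _ _ (by simp)]
  simp

lemma eval_smul_of_isHomogeneous {n ℓ : ℕ} {P : MvPolynomial (Fin n) ℝ} (hP : P.IsHomogeneous ℓ)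
    (t : ℝ) (x : EuclideanSpace ℝ (Fin n)) :
    MvPolynomial.eval (fun i => (t • x) i) P = t ^ ℓ * MvPolynomial.eval (fun i => x i) P := by
  rw [MvPolynomial.eval_eq, MvPolynomial.eval_eq, Finset.mul_sum]
  refine Finset.sum_congr rfl fun d hd => ?_
  have h := sum_eq_of_isHomogeneous hP hd
  have h' : ∏ i ∈ d.support, t ^ d i = t ^ ℓ := by
    rw [Finset.prod_pow_eq_pow_sum, ← h]
    congr 1
    exact Finset.sum_subset (Finset.subset_univ _) (by simp)
  simp only [PiLp.smul_apply, smul_eq_mul, mul_pow, Finset.prod_mul_distrib, h']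
  ring

lemma hasDerivAt_pow_mul_besselEntire {μ : ℝ} (hμ : 0 ≤ μ) (ℓ : ℕ) (t : ℝ) :
    HasDerivAt (fun t => t ^ ℓ * besselEntire μ (t ^ 2))
      (ℓ * t ^ (ℓ - 1) * besselEntire μ (t ^ 2) -
        t ^ ℓ * (t / 2 * besselEntire (μ + 1) (t ^ 2))) t := by
  have h := (hasDerivAt_pow ℓ t).mul
    ((hasDerivAt_besselEntire hμ (t ^ 2)).comp t (hasDerivAt_pow 2 t))
  refine h.congr_deriv ?_
  simp
  ring

lemma exists_integral_mul_eval_eq {n : ℕ} (hn : 2 ≤ n) {r : ℝ}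
    {f : EuclideanSpace ℝ (Fin n) → ℝ} (hf : ContDiff ℝ (⊤ : ℕ∞) f)
    (hfeq : ∀ x ∈ Metric.ball (0 : EuclideanSpace ℝ (Fin n)) r, laplacian f x + f x = 0)
    {ℓ : ℕ} {μ : ℝ} (hμ : 0 ≤ μ) (hℓ : μ + 1 = ℓ + (n : ℝ) / 2) {P : MvPolynomial (Fin n) ℝ}
    (hP : P.IsHomogeneous ℓ) (hΔ : polyLaplacian P = 0) :
    ∃ C : ℝ, ∀ t ∈ Set.Ico 0 r,
      ∫ η : UnitSphere n, f (t • (η : EuclideanSpace ℝ (Fin n))) *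
        MvPolynomial.eval (fun i => (η : EuclideanSpace ℝ (Fin n)) i) P ∂surfaceMeasure n =
      C * (t ^ ℓ * besselEntire μ (t ^ 2)) := by
  set p : EuclideanSpace ℝ (Fin n) → ℝ := fun x => MvPolynomial.eval (fun i => x i) P
  have hpc : Continuous p := (contDiff_eval P).continuous
  have hfc := hf.continuous
  have hf'c : Continuous (fderiv ℝ f) := hf.continuous_fderiv (by simp)
  set u : ℝ → ℝ := fun t => t ^ ℓ * besselEntire μ (t ^ 2)
  set u' : ℝ → ℝ := fun t => ℓ * t ^ (ℓ - 1) * besselEntire μ (t ^ 2) -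
        t ^ ℓ * (t / 2 * besselEntire (μ + 1) (t ^ 2)) with hu'
  have hu : ∀ t, HasDerivAt u (u' t) t := hasDerivAt_pow_mul_besselEntire hμ ℓ
  have hbc := (contDiff_besselEntire hμ).continuous
  have hbc' := (contDiff_besselEntire (show 0 ≤ μ + 1 by linarith)).continuous
  set a : ℝ → ℝ := fun t => ∫ η : UnitSphere n,
    f (t • (η : EuclideanSpace ℝ (Fin n))) * p η ∂surfaceMeasure n
  set a' : ℝ → ℝ := fun t => ∫ η : UnitSphere n,
    fderiv ℝ f (t • (η : EuclideanSpace ℝ (Fin n))) η * p η ∂surfaceMeasure n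
  have ha : ∀ t, HasDerivAt a (a' t) t := by
    refine fun t => hasDerivAt_integral_of_continuous (surfaceMeasure n)
      (F := fun t η => f (t • (η : EuclideanSpace ℝ (Fin n))) * p η)
      (F' := fun t η => fderiv ℝ f (t • (η : EuclideanSpace ℝ (Fin n))) η * p η) ?_ ?_ ?_ t
    · unfold Function.uncurry; fun_prop
    · unfold Function.uncurry; fun_prop
    · intro t η
      have h1 : HasDerivAt (fun t : ℝ => t • (η : EuclideanSpace ℝ (Fin n)))
          (η : EuclideanSpace ℝ (Fin n)) t := by
        simpa using (hasDerivAt_id t).smul_const (η : EuclideanSpace ℝ (Fin n))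
      exact ((hf.differentiable (by simp) _).hasFDerivAt.comp_hasDerivAt t h1).mul_const _
  have ha' : Continuous a' := by
    have h := continuous_parametric_integral_of_continuous
      (μ := surfaceMeasure n)
      (f := fun (t : ℝ) (η : UnitSphere n) =>
        fderiv ℝ f (t • (η : EuclideanSpace ℝ (Fin n))) η * p η) (by
          unfold Function.uncurry; fun_prop) isCompact_univ
    simpa using h
  have hV := contDiff_polyMulBessel hμ P
  have hVu : ∀ (t : ℝ) (η : UnitSphere n),
      polyMulBessel μ P (t • (η : EuclideanSpace ℝ (Fin n))) = u t * p η := by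
    intro t η
    simp only [polyMulBessel, eval_smul_of_isHomogeneous hP, norm_smul, norm_eq_of_mem_sphere, u, p]
    simp
    ring
  have hVu' : ∀ (t : ℝ) (η : UnitSphere n),
      fderiv ℝ (polyMulBessel μ P) (t • (η : EuclideanSpace ℝ (Fin n)))
        (t • (η : EuclideanSpace ℝ (Fin n))) = t * (u' t * p η) := by
    intro t η
    have h1 : HasDerivAt (fun t : ℝ => t • (η : EuclideanSpace ℝ (Fin n)))
        (η : EuclideanSpace ℝ (Fin n)) t := by
      simpa using (hasDerivAt_id t).smul_const (η : EuclideanSpace ℝ (Fin n))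
    have h2 := (hV.differentiable (by simp) _).hasFDerivAt.comp_hasDerivAt t h1
    have h3 : (polyMulBessel μ P ∘ fun t : ℝ => t • (η : EuclideanSpace ℝ (Fin n))) =
        fun t => u t * p η := funext fun t => hVu t η
    rw [h3] at h2
    rw [map_smul, h2.unique ((hu t).mul_const (p η)), smul_eq_mul]
  have hw : ∀ t ∈ Set.Ioo 0 r, a t * u' t = u t * a' t := by
    intro t ht
    have h := integral_toSphere_wronskian_eq_zero hn hf hV hfeq
      (laplacian_polyMulBessel_add_self hμ hℓ hP hΔ) ht
    have hpt : ∀ η : UnitSphere n, f (t • (η : EuclideanSpace ℝ (Fin n))) * (t * (u' t * p η)) -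
        u t * p η * (t * fderiv ℝ f (t • (η : EuclideanSpace ℝ (Fin n))) η) =
        t * u' t * (f (t • (η : EuclideanSpace ℝ (Fin n))) * p η) -
        t * u t * (fderiv ℝ f (t • (η : EuclideanSpace ℝ (Fin n))) η * p η) := fun η => by ring
    simp_rw [hVu, hVu', map_smul, smul_eq_mul] at h
    simp_rw [hpt] at h
    rw [integral_sub, integral_const_mul, integral_const_mul] at h
    · refine mul_left_cancel₀ ht.1.ne' ?_
      linear_combination h
    · exact (by fun_prop : Continuous _).integrable_of_hasCompactSupport
        (HasCompactSupport.of_compactSpace _)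
    · exact (by fun_prop : Continuous _).integrable_of_hasCompactSupport
        (HasCompactSupport.of_compactSpace _)
  have hne : ∀ t ∈ Set.Ioo 0 r, u t ≠ 0 ∨ u' t ≠ 0 := by
    intro t ht
    have ht0 : t ≠ 0 := ht.1.ne'
    by_cases h0 : besselEntire μ (t ^ 2) = 0
    · right
      have h1 := (besselEntire_ne_zero_or hμ (pow_pos ht.1 2)).resolve_left (not_not.2 h0)
      simp [hu', h0, h1, ht0]
    · exact Or.inl (mul_ne_zero (pow_ne_zero _ ht0) h0)
  obtain ⟨C, hC⟩ := exists_eq_const_mul_of_wronskian_eq_zero hu ha (by fun_prop) ha' hw hne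
  refine ⟨C, fun t ht => ?_⟩
  have hac : Continuous a := continuous_iff_continuousAt.2 fun t => (ha t).continuousAt
  have hEq : Set.EqOn a (fun t => C * u t) (Set.Icc 0 r) :=
    Set.EqOn.of_subset_closure hC hac.continuousOn (by fun_prop) Set.Ioo_subset_Icc_self
      (closure_Ioo (ht.1.trans_lt ht.2).ne).ge
  exact hEq ⟨ht.1, ht.2.le⟩

/-! ### Integrals of families of polynomials -/

lemma exists_polynomial_eq_integral {α : Type*} [TopologicalSpace α] [CompactSpace α]
    [MeasurableSpace α] [OpensMeasurableSpace α] (μ : Measure α) [IsFiniteMeasure μ] {n ℓ : ℕ}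
    {g : α → ℝ} (hg : Continuous g) {Z : α → MvPolynomial (Fin n) ℝ}
    (hZ : ∀ a, (Z a).IsHomogeneous ℓ) (hZc : ∀ d, Continuous fun a => (Z a).coeff d) :
    ∃ Q : MvPolynomial (Fin n) ℝ, ∀ L : MvPolynomial (Fin n) ℝ →ₗ[ℝ] ℝ,
      L Q = ∫ a, g a * L (Z a) ∂μ := by
  set T := (Finset.univ : Finset (Fin n)).finsuppAntidiag ℓ
  have hsum : ∀ a, Z a = ∑ d ∈ T, (Z a).coeff d • MvPolynomial.monomial d (1 : ℝ) := by
    intro a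
    conv_lhs => rw [(Z a).as_sum]
    rw [Finset.sum_subset (s₂ := T)]
    · simp [MvPolynomial.smul_monomial]
    · intro d hd
      exact Finset.mem_finsuppAntidiag.2
        ⟨sum_eq_of_isHomogeneous (hZ a) hd, Finset.subset_univ _⟩
    · intro d _ hd
      rw [MvPolynomial.notMem_support_iff.1 hd, map_zero]
  refine ⟨∑ d ∈ T, (∫ a, g a * (Z a).coeff d ∂μ) • MvPolynomial.monomial d (1 : ℝ), fun L => ?_⟩
  have hL : ∀ a, g a * L (Z a) =
      ∑ d ∈ T, g a * (Z a).coeff d * L (MvPolynomial.monomial d (1 : ℝ)) := by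
    intro a
    conv_lhs => rw [hsum a]
    simp [Finset.mul_sum, mul_assoc]
  simp_rw [hL]
  rw [integral_finsetSum]
  · simp [integral_mul_const]
  · intro d _
    have := hZc d
    exact (by fun_prop : Continuous _).integrable_of_hasCompactSupport
      (HasCompactSupport.of_compactSpace _)

lemma continuous_coeff_mul {α : Type*} [TopologicalSpace α] {n : ℕ}
    {p q : α → MvPolynomial (Fin n) ℝ} (hp : ∀ d, Continuous fun a => (p a).coeff d)
    (hq : ∀ d, Continuous fun a => (q a).coeff d) (d : Fin n →₀ ℕ) :
    Continuous fun a => (p a * q a).coeff d := by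
  simp_rw [MvPolynomial.coeff_mul]
  fun_prop

lemma continuous_coeff_pow {α : Type*} [TopologicalSpace α] {n : ℕ}
    {p : α → MvPolynomial (Fin n) ℝ} (hp : ∀ d, Continuous fun a => (p a).coeff d) (k : ℕ) :
    ∀ d, Continuous fun a => (p a ^ k).coeff d := by
  induction k with
  | zero => simp [continuous_const]
  | succ k ih =>
    simp_rw [pow_succ]
    exact continuous_coeff_mul ih hp

lemma continuous_coeff_zonalPoly {n : ℕ} (m : ℕ) (d : Fin n →₀ ℕ) :
    Continuous fun y : EuclideanSpace ℝ (Fin n) =>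
      (zonalPoly m fun i => y i).coeff d := by
  have hlin : ∀ d, Continuous fun y : EuclideanSpace ℝ (Fin n) =>
      (linearFormPoly fun i => y i).coeff d := by
    intro d
    simp only [linearFormPoly, MvPolynomial.coeff_sum, MvPolynomial.coeff_C_mul]
    fun_prop
  simp only [zonalPoly, MvPolynomial.coeff_sum, MvPolynomial.coeff_C_mul]
  refine continuous_finsetSum _ fun j _ => continuous_const.mul ?_
  exact continuous_coeff_mul (fun _ => continuous_const)
    (continuous_coeff_pow hlin (m - 2 * j)) d

lemma sum_sq_eq_one {n : ℕ} (ω : UnitSphere n) :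
    ∑ i, (ω : EuclideanSpace ℝ (Fin n)) i ^ 2 = 1 := by
  rw [← EuclideanSpace.real_norm_sq_eq, norm_eq_of_mem_sphere, one_pow]

lemma eval_zonalPoly_sphere {n : ℕ} (m : ℕ) (ω η : UnitSphere n) :
    MvPolynomial.eval (fun i => (η : EuclideanSpace ℝ (Fin n)) i)
      (zonalPoly m fun i => (ω : EuclideanSpace ℝ (Fin n)) i) =
      (zonalProfile n m).eval (inner ℝ (ω : EuclideanSpace ℝ (Fin n)) η) := by
  rw [eval_zonalPoly _ _ _ (sum_sq_eq_one η), PiLp.inner_apply]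
  simp [mul_comm]

lemma eval_zonalPoly_symm {n : ℕ} (m : ℕ) (ω η : UnitSphere n) :
    MvPolynomial.eval (fun i => (ω : EuclideanSpace ℝ (Fin n)) i)
      (zonalPoly m fun i => (η : EuclideanSpace ℝ (Fin n)) i) =
      (zonalProfile n m).eval (inner ℝ (ω : EuclideanSpace ℝ (Fin n)) η) := by
  rw [eval_zonalPoly_sphere, real_inner_comm]

/-- The zonal integrals of a solution of the Helmholtz equation are separated solutions. -/
lemma exists_integral_mul_zonalProfile_eq {n : ℕ} (hn : 2 ≤ n) {r : ℝ} (hr : 0 < r)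
    {f : EuclideanSpace ℝ (Fin n) → ℝ} (hf : ContDiff ℝ (⊤ : ℕ∞) f)
    (hfeq : ∀ x ∈ Metric.ball (0 : EuclideanSpace ℝ (Fin n)) r, laplacian f x + f x = 0)
    (ℓ : ℕ) {μ : ℝ} (hμ : 0 ≤ μ) (hℓ : μ + 1 = ℓ + (n : ℝ) / 2) :
    ∃ Q : MvPolynomial (Fin n) ℝ, Q.IsHomogeneous ℓ ∧ polyLaplacian Q = 0 ∧
      ∀ t ∈ Set.Ico 0 r, ∀ ω : UnitSphere n,
        ∫ η : UnitSphere n, f (t • (η : EuclideanSpace ℝ (Fin n))) *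
          (zonalProfile n ℓ).eval (inner ℝ (ω : EuclideanSpace ℝ (Fin n)) η) ∂surfaceMeasure n =
        polyMulBessel μ Q (t • (ω : EuclideanSpace ℝ (Fin n))) := by
  set t₀ := min (r / 2) 1
  have ht₀ : 0 < t₀ := lt_min (by linarith) one_pos
  have ht₀r : t₀ < r := (min_le_left _ _).trans_lt (by linarith)
  have ht₀1 : t₀ ≤ 1 := min_le_right _ _
  have hb : besselEntire μ (t₀ ^ 2) ≠ 0 := by
    refine besselEntire_ne_zero_of_le hμ ?_
    rw [abs_of_pos (by positivity)]
    nlinarith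
  have hu : t₀ ^ ℓ * besselEntire μ (t₀ ^ 2) ≠ 0 := mul_ne_zero (by positivity) hb
  have hfc := hf.continuous
  let Z : UnitSphere n → MvPolynomial (Fin n) ℝ := fun η =>
    zonalPoly ℓ fun i => (η : EuclideanSpace ℝ (Fin n)) i
  obtain ⟨Q, hQ⟩ := exists_polynomial_eq_integral (surfaceMeasure n) (ℓ := ℓ)
    (g := fun η => f (t₀ • (η : EuclideanSpace ℝ (Fin n))) /
      (t₀ ^ ℓ * besselEntire μ (t₀ ^ 2))) (by fun_prop)
    (Z := Z) (fun η => isHomogeneous_zonalPoly ℓ _)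
    (fun d => (continuous_coeff_zonalPoly ℓ d).comp continuous_subtype_val)
  have hQh : Q.IsHomogeneous ℓ := by
    intro d hd
    by_contra hne
    refine hd ?_
    rw [← MvPolynomial.lcoeff_apply, hQ]
    refine (integral_congr_ae (Filter.Eventually.of_forall fun η => ?_)).trans (integral_zero' _ _)
    have : (Z η).coeff d = 0 := by
      by_contra h
      exact hne (isHomogeneous_zonalPoly ℓ _ h)
    simp [MvPolynomial.lcoeff_apply, this]
  have hQΔ : polyLaplacian Q = 0 := by
    ext d
    rw [← polyLaplacianₗ_apply]
    refine (hQ (MvPolynomial.lcoeff ℝ d ∘ₗ polyLaplacianₗ n)).trans ?_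
    refine (integral_congr_ae (Filter.Eventually.of_forall fun η => ?_)).trans (integral_zero' _ _)
    have : polyLaplacian (Z η) = 0 := polyLaplacian_zonalPoly hn ℓ _ (sum_sq_eq_one η)
    simp [polyLaplacianₗ_apply, this]
  refine ⟨Q, hQh, hQΔ, fun t ht ω => ?_⟩
  obtain ⟨C, hC⟩ := exists_integral_mul_eval_eq hn hf hfeq hμ hℓ
    (isHomogeneous_zonalPoly ℓ fun i => (ω : EuclideanSpace ℝ (Fin n)) i)
    (polyLaplacian_zonalPoly hn ℓ _ (sum_sq_eq_one ω))
  simp_rw [eval_zonalPoly_sphere] at hC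
  have hev : MvPolynomial.eval (fun i => (ω : EuclideanSpace ℝ (Fin n)) i) Q = C := by
    have h := hQ (MvPolynomial.aeval (fun i => (ω : EuclideanSpace ℝ (Fin n)) i)).toLinearMap
    simp only [AlgHom.toLinearMap_apply, MvPolynomial.aeval_eq_eval, Z,
      eval_zonalPoly_symm, div_mul_eq_mul_div, integral_div] at h
    rw [h, hC t₀ ⟨ht₀.le, ht₀r⟩, mul_div_cancel_right₀ _ hu]
  rw [hC t ht, polyMulBessel, eval_smul_of_isHomogeneous hQh, hev, norm_smul,
    norm_eq_of_mem_sphere]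
  simp
  ring

/-! ### Approximation by convolution with a polynomial kernel -/

lemma exists_continuous_kernel {n : ℕ} {δ : ℝ} (hδ : 0 < δ) :
    ∃ κ : ℝ → ℝ, Continuous κ ∧ (∀ s, 0 ≤ κ s) ∧ (∀ s ≤ 1 - δ, κ s = 0) ∧
      ∀ ω : UnitSphere n, ∫ η : UnitSphere n,
        κ (inner ℝ (ω : EuclideanSpace ℝ (Fin n)) η) ∂surfaceMeasure n = 1 := by
  rcases isEmpty_or_nonempty (UnitSphere n) with _ | ⟨⟨ω₀⟩⟩
  · exact ⟨fun _ => 0, continuous_const, fun _ => le_rfl, fun _ _ => rfl, isEmptyElim⟩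
  set κ₀ : ℝ → ℝ := fun s => max 0 (s - (1 - δ))
  have hκ₀ : Continuous κ₀ := by fun_prop
  set I := ∫ η : UnitSphere n, κ₀ (inner ℝ (ω₀ : EuclideanSpace ℝ (Fin n)) η) ∂surfaceMeasure n
    with hIdef
  have hI : 0 < I := by
    refine Continuous.integral_pos_of_hasCompactSupport_nonneg_nonzero (x := ω₀) (by fun_prop)
      (HasCompactSupport.of_compactSpace _) (fun η => le_max_left _ _) ?_
    rw [real_inner_self_eq_norm_sq, norm_eq_of_mem_sphere]
    simp only [κ₀]
    rw [max_eq_right (by linarith)]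
    linarith
  refine ⟨fun s => κ₀ s / I, by fun_prop, fun s => div_nonneg (le_max_left _ _) hI.le,
    fun s hs => ?_, fun ω => ?_⟩
  · simp only [κ₀]
    rw [max_eq_left (by linarith), zero_div]
  · rw [integral_div, integral_toSphere_inner_eq hκ₀ ω ω₀, ← hIdef, div_self hI.ne']

lemma exists_polynomial_kernel {n : ℕ} {F : EuclideanSpace ℝ (Fin n) → ℝ} (hF : Continuous F)
    {r ε : ℝ} (hε : 0 < ε) :
    ∃ p : Polynomial ℝ, ∀ t ∈ Set.Icc 0 r, ∀ ω : UnitSphere n,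
      |F (t • (ω : EuclideanSpace ℝ (Fin n))) -
        ∫ η : UnitSphere n, F (t • (η : EuclideanSpace ℝ (Fin n))) *
          p.eval (inner ℝ (ω : EuclideanSpace ℝ (Fin n)) η) ∂surfaceMeasure n| < ε := by
  have hball := isCompact_closedBall (0 : EuclideanSpace ℝ (Fin n)) r
  obtain ⟨δ', hδ', hFδ⟩ := Metric.uniformContinuousOn_iff.1
    (hball.uniformContinuousOn_of_continuous hF.continuousOn) (ε / 2) (by linarith)
  obtain ⟨M₀, hM₀⟩ := hball.exists_bound_of_continuousOn hF.continuousOn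
  set M := max M₀ 0
  have hM0 : 0 ≤ M := le_max_right _ _
  set δ := δ' ^ 2 / (2 * (r ^ 2 + 1)) with hδdef
  have hδ : 0 < δ := by positivity
  obtain ⟨κ, hκ, hκ0, hκδ, hκ1⟩ := exists_continuous_kernel (n := n) hδ
  set S := (surfaceMeasure n).real Set.univ
  have hS : 0 ≤ S := measureReal_nonneg
  obtain ⟨p, hp⟩ := exists_polynomial_near_of_continuousOn (-1) 1 κ hκ.continuousOn
    (ε / (2 * (M * S + 1))) (by positivity)
  refine ⟨p, fun t ht ω => ?_⟩
  have hmem : ∀ η : UnitSphere n, t • (η : EuclideanSpace ℝ (Fin n)) ∈ Metric.closedBall 0 r := by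
    intro η
    rw [mem_closedBall_zero_iff, norm_smul, norm_eq_of_mem_sphere, mul_one, Real.norm_eq_abs,
      abs_of_nonneg ht.1]
    exact ht.2
  have hint : ∀ {g : UnitSphere n → ℝ}, Continuous g → Integrable g (surfaceMeasure n) :=
    fun hg => hg.integrable_of_hasCompactSupport (HasCompactSupport.of_compactSpace _)
  set q : UnitSphere n → ℝ := fun η => inner ℝ (ω : EuclideanSpace ℝ (Fin n)) η
  have hq : Continuous q := by fun_prop
  have hclose : ∀ η : UnitSphere n, 1 - δ < q η →
      |F (t • (ω : EuclideanSpace ℝ (Fin n))) - F (t • (η : EuclideanSpace ℝ (Fin n)))| ≤ ε / 2 := by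
    intro η hη
    refine (hFδ _ (hmem ω) _ (hmem η) ?_).le
    rw [dist_eq_norm, ← smul_sub, norm_smul, Real.norm_eq_abs, abs_of_nonneg ht.1]
    refine lt_of_pow_lt_pow_left₀ 2 hδ'.le ?_
    rw [mul_pow, norm_sub_sq_real, norm_eq_of_mem_sphere, norm_eq_of_mem_sphere]
    have h1 : t ^ 2 ≤ r ^ 2 := pow_le_pow_left₀ ht.1 ht.2 2
    have h2 : 2 * (r ^ 2 + 1) * δ = δ' ^ 2 := by rw [hδdef]; field_simp
    have h3 : 1 ^ 2 - 2 * q η + 1 ^ 2 < 2 * δ := by linarith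
    calc t ^ 2 * (1 ^ 2 - 2 * q η + 1 ^ 2) ≤ t ^ 2 * (2 * δ) := by gcongr
      _ ≤ r ^ 2 * (2 * δ) := by gcongr
      _ < 2 * (r ^ 2 + 1) * δ := by linarith
      _ = δ' ^ 2 := h2
  have h1 : |∫ η : UnitSphere n, (F (t • (ω : EuclideanSpace ℝ (Fin n))) -
      F (t • (η : EuclideanSpace ℝ (Fin n)))) * κ (q η) ∂surfaceMeasure n| ≤ ε / 2 := by
    rw [← Real.norm_eq_abs]
    refine (norm_integral_le_of_norm_le (g := fun η => ε / 2 * κ (q η))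
      (hint (by fun_prop)) (Filter.Eventually.of_forall fun η => ?_)).trans_eq ?_
    · rw [norm_mul, Real.norm_eq_abs, Real.norm_eq_abs, abs_of_nonneg (hκ0 _)]
      rcases le_or_gt (q η) (1 - δ) with h | h
      · simp [hκδ _ h]
      · exact mul_le_mul_of_nonneg_right (hclose η h) (hκ0 _)
    · rw [integral_const_mul, hκ1, mul_one]
  have h2 : |∫ η : UnitSphere n, F (t • (η : EuclideanSpace ℝ (Fin n))) *
      (p.eval (q η) - κ (q η)) ∂surfaceMeasure n| < ε / 2 := by
    have hb := norm_integral_le_of_norm_le_const (μ := surfaceMeasure n)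
      (f := fun η : UnitSphere n => F (t • (η : EuclideanSpace ℝ (Fin n))) *
        (p.eval (q η) - κ (q η))) (C := M * (ε / (2 * (M * S + 1))))
      (Filter.Eventually.of_forall fun η => ?_)
    · refine hb.trans_lt ?_
      change M * (ε / (2 * (M * S + 1))) * S < ε / 2
      have hpos : 0 < M * S + 1 := by positivity
      rw [show M * (ε / (2 * (M * S + 1))) * S = ε / 2 * (M * S / (M * S + 1)) by field_simp]
      have : M * S / (M * S + 1) < 1 := (div_lt_one hpos).2 (by linarith)
      nlinarith
    · rw [norm_mul]
      have hq1 : |q η| ≤ 1 := by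
        have := abs_real_inner_le_norm (ω : EuclideanSpace ℝ (Fin n)) η
        simpa using this
      exact mul_le_mul ((hM₀ _ (hmem η)).trans (le_max_left _ _)) (hp _ (abs_le.1 hq1)).le
        (norm_nonneg _) hM0
  have hpc : Continuous fun s => p.eval s := p.continuous
  have heq : F (t • (ω : EuclideanSpace ℝ (Fin n))) -
      ∫ η : UnitSphere n, F (t • (η : EuclideanSpace ℝ (Fin n))) * p.eval (q η) ∂surfaceMeasure n =
      (∫ η : UnitSphere n, (F (t • (ω : EuclideanSpace ℝ (Fin n))) -
        F (t • (η : EuclideanSpace ℝ (Fin n)))) * κ (q η) ∂surfaceMeasure n) -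
      ∫ η : UnitSphere n, F (t • (η : EuclideanSpace ℝ (Fin n))) *
        (p.eval (q η) - κ (q η)) ∂surfaceMeasure n := by
    simp_rw [sub_mul, mul_sub]
    rw [integral_sub (hint (by fun_prop)) (hint (by fun_prop)),
      integral_sub (hint (by fun_prop)) (hint (by fun_prop)), integral_const_mul, hκ1]
    ring
  rw [heq]
  have := abs_sub (∫ η : UnitSphere n, (F (t • (ω : EuclideanSpace ℝ (Fin n))) -
        F (t • (η : EuclideanSpace ℝ (Fin n)))) * κ (q η) ∂surfaceMeasure n)
      (∫ η : UnitSphere n, F (t • (η : EuclideanSpace ℝ (Fin n))) *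
        (p.eval (q η) - κ (q η)) ∂surfaceMeasure n)
  linarith

/-! ### Completeness of the separated solutions -/

lemma exists_contDiff_eqOn_ball {n : ℕ} {r R : ℝ} (hr : 0 < r) (hrR : r < R)
    {f : EuclideanSpace ℝ (Fin n) → ℝ}
    (hf : ContDiffOn ℝ (⊤ : ℕ∞) f (Metric.ball (0 : EuclideanSpace ℝ (Fin n)) R)) :
    ∃ F : EuclideanSpace ℝ (Fin n) → ℝ, ContDiff ℝ (⊤ : ℕ∞) F ∧
      Set.EqOn F f (Metric.ball 0 r) := by
  let φ : ContDiffBump (0 : EuclideanSpace ℝ (Fin n)) :=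
    ⟨r, (r + R) / 2, hr, by linarith⟩
  refine ⟨fun x => φ x * f x, contDiff_iff_contDiffAt.2 fun x => ?_, fun x hx => ?_⟩
  · by_cases hx : x ∈ Metric.ball (0 : EuclideanSpace ℝ (Fin n)) R
    · exact φ.contDiffAt.mul (hf.contDiffAt (Metric.isOpen_ball.mem_nhds hx))
    · have hx' : (r + R) / 2 < dist x 0 := by
        rw [Metric.mem_ball, not_lt] at hx
        linarith
      refine (contDiffAt_const (c := (0 : ℝ))).congr_of_eventuallyEq ?_
      filter_upwards [(by fun_prop : Continuous fun y : EuclideanSpace ℝ (Fin n) =>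
        dist y 0).continuousAt.eventually_const_lt hx']
        with y hy
      rw [φ.zero_of_le_dist (le_of_lt hy), zero_mul]
  · simp only
    rw [φ.one_of_mem_closedBall (Metric.ball_subset_closedBall hx), one_mul]

lemma laplacian_congr_of_eqOn {n : ℕ} {f g : EuclideanSpace ℝ (Fin n) → ℝ}
    {U : Set (EuclideanSpace ℝ (Fin n))} (hU : IsOpen U) (h : Set.EqOn f g U)
    {x : EuclideanSpace ℝ (Fin n)} (hx : x ∈ U) : laplacian f x = laplacian g x := by
  refine Finset.sum_congr rfl fun i _ => ?_
  rw [Filter.EventuallyEq.fderiv_eq]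
  filter_upwards [hU.mem_nhds hx] with y hy
  rw [(Filter.eventuallyEq_of_mem (hU.mem_nhds hy) h).fderiv_eq]

lemma exists_smul_unitSphere_eq {n : ℕ} (hn : 2 ≤ n) (x : EuclideanSpace ℝ (Fin n)) :
    ∃ ω : UnitSphere n, ‖x‖ • (ω : EuclideanSpace ℝ (Fin n)) = x := by
  by_cases hx : x = 0
  · exact ⟨⟨EuclideanSpace.single ⟨0, by omega⟩ 1, by simp⟩, by simp [hx]⟩
  · exact ⟨⟨‖x‖⁻¹ • x, by simp [norm_smul, hx]⟩, by simp [smul_smul, hx]⟩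

theorem stmt11 (n : ℕ) (hn : 2 ≤ n)
    (ν : ℝ) (hν : ν = ((n : ℝ) - 2) / 2)
    (R : ℝ) (hR : 0 < R)
    (f : EuclideanSpace ℝ (Fin n) → ℝ)
    (hf : ContDiffOn ℝ (⊤ : ℕ∞) f (Metric.ball (0 : EuclideanSpace ℝ (Fin n)) R))
    (hfeq : ∀ x ∈ Metric.ball (0 : EuclideanSpace ℝ (Fin n)) R, laplacian f x + f x = 0)
    (K : Set (EuclideanSpace ℝ (Fin n))) (hK : IsCompact K)
    (hKB : K ⊆ Metric.ball (0 : EuclideanSpace ℝ (Fin n)) R)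
    (ε : ℝ) (hε : 0 < ε) :
    ∃ (N : ℕ) (ℓ : Fin N → ℕ) (P : Fin N → MvPolynomial (Fin n) ℝ) (c : Fin N → ℝ)
      (g : Fin N → EuclideanSpace ℝ (Fin n) → ℝ),
      (∀ j, (P j).IsHomogeneous (ℓ j)) ∧
      (∀ j, polyLaplacian (P j) = 0) ∧
      (∀ j, ContDiff ℝ (⊤ : ℕ∞) (g j)) ∧
      (∀ j, ∀ x : EuclideanSpace ℝ (Fin n), x ≠ 0 →
        g j x = MvPolynomial.eval (fun i => x i) (P j) *
          besselJ ((ℓ j : ℝ) + ν) ‖x‖ / ‖x‖ ^ ((ℓ j : ℝ) + ν)) ∧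
      (∀ x ∈ K, |f x - ∑ j, c j * g j x| < ε) := by
  obtain ⟨r₀, hr₀R, hKr₀⟩ := exists_lt_subset_ball hK.isClosed hKB
  set r := max r₀ (R / 2)
  have hr : 0 < r := lt_max_of_lt_right (by linarith)
  have hrR : r < R := max_lt hr₀R (by linarith)
  have hKr : K ⊆ Metric.ball (0 : EuclideanSpace ℝ (Fin n)) r :=
    hKr₀.trans (Metric.ball_subset_ball (le_max_left _ _))
  obtain ⟨F, hF, hFf⟩ := exists_contDiff_eqOn_ball hr hrR hf
  have hFeq : ∀ x ∈ Metric.ball (0 : EuclideanSpace ℝ (Fin n)) r, laplacian F x + F x = 0 := by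
    intro x hx
    rw [laplacian_congr_of_eqOn Metric.isOpen_ball hFf hx, hFf hx]
    exact hfeq x (Metric.ball_subset_ball hrR.le hx)
  have hFc := hF.continuous
  have hν0 : 0 ≤ ν := by
    have : (2 : ℝ) ≤ n := by exact_mod_cast hn
    linarith
  have hμ : ∀ ℓ : ℕ, 0 ≤ (ℓ : ℝ) + ν := fun ℓ => by positivity
  choose Q hQh hQΔ hQ using fun ℓ : ℕ =>
    exists_integral_mul_zonalProfile_eq hn hr hF hFeq ℓ (hμ ℓ) (by rw [hν]; ring)
  obtain ⟨p, hp⟩ := exists_polynomial_kernel hFc (r := r) hε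
  obtain ⟨κ, hκ⟩ := exists_eq_sum_zonalProfile n p
  let e := κ.support.equivFin.symm
  refine ⟨κ.support.card, fun j => e j, fun j => Q (e j),
    fun j => κ (e j) * 2 ^ (((e j : ℕ) : ℝ) + ν),
    fun j x => (2 ^ (((e j : ℕ) : ℝ) + ν))⁻¹ * polyMulBessel ((e j : ℕ) + ν) (Q (e j)) x,
    fun j => hQh _, fun j => hQΔ _,
    fun j => contDiff_const.mul (contDiff_polyMulBessel (hμ _) _), fun j x hx => ?_,
    fun x hx => ?_⟩
  · rw [mul_div_assoc, besselJ_div_rpow (norm_pos_iff.2 hx)]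
    simp only [polyMulBessel]
    ring
  · obtain ⟨ω, hω⟩ := exists_smul_unitSphere_eq hn x
    have hxr : ‖x‖ < r := mem_ball_zero_iff.1 (hKr hx)
    have h := hp ‖x‖ ⟨norm_nonneg x, hxr.le⟩ ω
    have hpQ : ∫ η : UnitSphere n, F (‖x‖ • (η : EuclideanSpace ℝ (Fin n))) *
        p.eval (inner ℝ (ω : EuclideanSpace ℝ (Fin n)) η) ∂surfaceMeasure n =
        ∑ ℓ ∈ κ.support, κ ℓ * polyMulBessel (ℓ + ν) (Q ℓ) x := by
      have hpt : ∀ η : UnitSphere n, F (‖x‖ • (η : EuclideanSpace ℝ (Fin n))) *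
          p.eval (inner ℝ (ω : EuclideanSpace ℝ (Fin n)) η) =
          ∑ ℓ ∈ κ.support, κ ℓ * (F (‖x‖ • (η : EuclideanSpace ℝ (Fin n))) *
            (zonalProfile n ℓ).eval (inner ℝ (ω : EuclideanSpace ℝ (Fin n)) η)) := by
        intro η
        conv_lhs => rw [hκ]
        rw [Polynomial.eval_finsetSum, Finset.mul_sum]
        refine Finset.sum_congr rfl fun ℓ _ => ?_
        rw [Polynomial.eval_smul, smul_eq_mul]
        ring
      simp_rw [hpt]
      rw [integral_finsetSum]
      · refine Finset.sum_congr rfl fun ℓ _ => ?_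
        rw [integral_const_mul, hQ ℓ _ ⟨norm_nonneg x, hxr⟩, hω]
      · intro ℓ _
        have hc : Continuous fun s => (zonalProfile n ℓ).eval s := (zonalProfile n ℓ).continuous
        exact (by fun_prop : Continuous _).integrable_of_hasCompactSupport
          (HasCompactSupport.of_compactSpace _)
    have hsum : ∑ j : Fin κ.support.card, κ (e j) * 2 ^ (((e j : ℕ) : ℝ) + ν) *
        ((2 ^ (((e j : ℕ) : ℝ) + ν))⁻¹ * polyMulBessel ((e j : ℕ) + ν) (Q (e j)) x) =
        ∑ ℓ ∈ κ.support, κ ℓ * polyMulBessel (ℓ + ν) (Q ℓ) x := by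
      rw [← Finset.sum_coe_sort κ.support, ← e.sum_comp]
      refine Finset.sum_congr rfl fun j _ => ?_
      have : (2 : ℝ) ^ (((e j : ℕ) : ℝ) + ν) ≠ 0 := (rpow_pos_of_pos two_pos _).ne'
      field_simp
    rw [hpQ, hω, hFf (hKr hx)] at h
    rwa [hsum]
end
end

section
/- Let n ≥ 2, let c̃ ⊂ ℝ^n be a compact smooth embedded hypersurface (an (n−1)-dimensional smooth embedded submanifold of ℝ^n), and let ε > 0. Then there exist a diffeomorphism Ψ : ℝ^n → ℝ^n with sup_{x∈ℝ^n} |Ψ(x) − x| < ε, an open set V ⊂ ℝ^n containing Ψ(c̃), and a real analytic function F : V → ℝ with nonvanishing gradient on V, such that Ψ(c̃) = F^{−1}(0). In particular, every compact smooth embedded hypersurface in ℝ^n is diffeomorphic, via a diffeomorphism of ℝ^n that is ε-close to the identity, to a real analytic hypersurface. -/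
open MeasureTheory Real

noncomputable section

/-- `c` is a smooth embedded hypersurface of `ℝ^n`: near each of its points it is a regular
level set of a smooth function. -/
def IsSmoothHypersurface {n : ℕ} (c : Set (EuclideanSpace ℝ (Fin n))) : Prop :=
  ∀ x ∈ c, ∃ (U : Set (EuclideanSpace ℝ (Fin n))) (F : EuclideanSpace ℝ (Fin n) → ℝ),
    IsOpen U ∧ x ∈ U ∧ ContDiffOn ℝ (⊤ : ℕ∞) F U ∧ (∀ y ∈ U, fderiv ℝ F y ≠ 0) ∧
    c ∩ U = {y ∈ U | F y = 0}

section Signs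

open Set Filter Topology

variable {E : Type*} [NormedAddCommGroup E] [NormedSpace ℝ E]

/-- Two defining functions with the same zeros near `y` which both increase in a common direction
have the same sign near `y`. -/
theorem eventually_sign_eq_of_fderiv_pos {F₁ F₂ : E → ℝ} {y v : E}
    (h₁ : ContDiffAt ℝ 1 F₁ y) (h₂ : ContDiffAt ℝ 1 F₂ y) (hy : F₁ y = 0)
    (hv₁ : 0 < fderiv ℝ F₁ y v) (hv₂ : 0 < fderiv ℝ F₂ y v)
    (hz : ∀ᶠ z in 𝓝 y, F₁ z = 0 ↔ F₂ z = 0) :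
    ∀ᶠ z in 𝓝 y, SignType.sign (F₁ z) = SignType.sign (F₂ z) := by
  have ev : ∀ F : E → ℝ, ContDiffAt ℝ 1 F y → 0 < fderiv ℝ F y v →
      ∀ᶠ z in 𝓝 y, DifferentiableAt ℝ F z ∧ 0 < fderiv ℝ F z v := by
    intro F hF hFv
    have hc : ContinuousAt (fun z => fderiv ℝ F z v) y :=
      (hF.continuousAt_fderiv (by norm_num)).clm_apply continuousAt_const
    filter_upwards [hF.eventually (by simp), hc.eventually_const_lt hFv] with z hz hz'
    exact ⟨hz.differentiableAt (by norm_num), hz'⟩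
  obtain ⟨r, hr, hball⟩ := Metric.eventually_nhds_iff_ball.1
    ((ev F₁ h₁ hv₁).and ((ev F₂ h₂ hv₂).and hz))
  obtain ⟨τ, hτ, hτr⟩ : ∃ τ : ℝ, 0 < τ ∧ τ * ‖v‖ < r / 2 := by
    refine ⟨r / 2 / (‖v‖ + 1), by positivity, ?_⟩
    rw [div_mul_eq_mul_div, div_lt_iff₀ (by positivity)]
    nlinarith [norm_nonneg v]
  have hmem : ∀ z ∈ Metric.ball y (r / 2), ∀ t ∈ Icc (-τ) τ, z + t • v ∈ Metric.ball y r := by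
    intro z hz t ht
    have h1 : ‖t • v‖ ≤ τ * ‖v‖ := by
      rw [norm_smul]
      exact mul_le_mul_of_nonneg_right (abs_le.2 ht) (norm_nonneg v)
    rw [mem_ball_iff_norm] at hz ⊢
    calc ‖z + t • v - y‖ = ‖(z - y) + t • v‖ := by congr 1; abel
      _ ≤ ‖z - y‖ + ‖t • v‖ := norm_add_le _ _
      _ < r := by linarith
  have mono : ∀ F : E → ℝ, (∀ z ∈ Metric.ball y r, DifferentiableAt ℝ F z ∧ 0 < fderiv ℝ F z v) →
      ∀ z ∈ Metric.ball y (r / 2), StrictMonoOn (fun t : ℝ => F (z + t • v)) (Icc (-τ) τ) := by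
    intro F hF z hz
    have hd : ∀ t ∈ Icc (-τ) τ,
        HasDerivAt (fun t : ℝ => F (z + t • v)) (fderiv ℝ F (z + t • v) v) t := by
      intro t ht
      have h1 : HasDerivAt (fun t : ℝ => z + t • v) v t := by
        simpa using ((hasDerivAt_id t).smul_const v).const_add z
      exact (hF _ (hmem z hz t ht)).1.hasFDerivAt.comp_hasDerivAt t h1
    refine strictMonoOn_of_deriv_pos (convex_Icc _ _)
      (fun t ht => (hd t ht).continuousAt.continuousWithinAt) fun t ht => ?_
    rw [interior_Icc] at ht
    rw [(hd t (Ioo_subset_Icc_self ht)).deriv]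
    exact (hF _ (hmem z hz t (Ioo_subset_Icc_self ht))).2
  have m₁ := mono F₁ fun z hz => (hball z hz).1
  have m₂ := mono F₂ fun z hz => (hball z hz).2.1
  have hyb : y ∈ Metric.ball y (r / 2) := Metric.mem_ball_self (by positivity)
  have h0 : (0 : ℝ) ∈ Icc (-τ) τ := ⟨by linarith, hτ.le⟩
  have hl : (-τ) ∈ Icc (-τ) τ := ⟨le_rfl, by linarith⟩
  have hu : τ ∈ Icc (-τ) τ := ⟨by linarith, le_rfl⟩
  have cont : ∀ t ∈ Icc (-τ) τ, ContinuousAt (fun z => F₁ (z + t • v)) y := fun t ht =>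
    ContinuousAt.comp (f := fun z => z + t • v) (hball _ (hmem y hyb t ht)).1.1.continuousAt
      (by fun_prop)
  have hneg : F₁ (y + (-τ) • v) < 0 := by
    have := m₁ y hyb hl h0 (by linarith)
    simpa [hy] using this
  have hpos : 0 < F₁ (y + τ • v) := by
    have := m₁ y hyb h0 hu hτ
    simpa [hy] using this
  filter_upwards [(cont _ hl).eventually_lt_const hneg, (cont _ hu).eventually_const_lt hpos,
    Metric.ball_mem_nhds y (half_pos hr)] with z hz₁ hz₂ hzb
  have hcont : ContinuousOn (fun t : ℝ => F₁ (z + t • v)) (Icc (-τ) τ) := fun t ht =>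
    (ContinuousAt.comp (f := fun t : ℝ => z + t • v)
      (hball _ (hmem z hzb t ht)).1.1.continuousAt (by fun_prop)).continuousWithinAt
  obtain ⟨t, ht, ht0⟩ := intermediate_value_Icc (by linarith) hcont ⟨hz₁.le, hz₂.le⟩
  have ht0' : F₂ (z + t • v) = 0 := (hball _ (hmem z hzb t ht)).2.2.1 ht0
  rcases lt_trichotomy t 0 with h | h | h
  · have a₁ := m₁ z hzb ht h0 h
    have a₂ := m₂ z hzb ht h0 h
    simp only [zero_smul, add_zero, ht0, ht0'] at a₁ a₂
    rw [sign_pos a₁, sign_pos a₂]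
  · subst h
    simp only [zero_smul, add_zero] at ht0 ht0'
    rw [ht0, ht0']
  · have a₁ := m₁ z hzb h0 ht h
    have a₂ := m₂ z hzb h0 ht h
    simp only [zero_smul, add_zero, ht0, ht0'] at a₁ a₂
    rw [sign_neg a₁, sign_neg a₂]

/-- Two defining functions of the same hypersurface germ have, up to a global sign, the same
signs. -/
theorem eventually_sign_eq_or_eq_neg {F₁ F₂ : E → ℝ} {y : E}
    (h₁ : ContDiffAt ℝ 1 F₁ y) (h₂ : ContDiffAt ℝ 1 F₂ y) (hy : F₁ y = 0)
    (hd₁ : fderiv ℝ F₁ y ≠ 0) (hd₂ : fderiv ℝ F₂ y ≠ 0)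
    (hz : ∀ᶠ z in 𝓝 y, F₁ z = 0 ↔ F₂ z = 0) :
    (∀ᶠ z in 𝓝 y, SignType.sign (F₁ z) = SignType.sign (F₂ z)) ∨
      ∀ᶠ z in 𝓝 y, SignType.sign (F₁ z) = -SignType.sign (F₂ z) := by
  obtain ⟨v, hv₁, hv₂⟩ : ∃ v, fderiv ℝ F₁ y v ≠ 0 ∧ fderiv ℝ F₂ y v ≠ 0 := by
    obtain ⟨v₁, hv₁⟩ := DFunLike.ne_iff.1 hd₁
    obtain ⟨v₂, hv₂⟩ := DFunLike.ne_iff.1 hd₂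
    simp only [zero_apply] at hv₁ hv₂
    by_cases h1 : fderiv ℝ F₂ y v₁ = 0
    · by_cases h2 : fderiv ℝ F₁ y v₂ = 0
      · exact ⟨v₁ + v₂, by simpa [h2] using hv₁, by simpa [h1] using hv₂⟩
      · exact ⟨v₂, h2, hv₂⟩
    · exact ⟨v₁, hv₁, h1⟩
  wlog hp : 0 < fderiv ℝ F₁ y v generalizing v
  · refine this (-v) (by simpa using hv₁) (by simpa using hv₂) ?_
    rw [map_neg]
    exact neg_pos.2 (lt_of_le_of_ne (not_lt.1 hp) hv₁)
  rcases lt_or_gt_of_ne hv₂ with h | h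
  · right
    have key := eventually_sign_eq_of_fderiv_pos (F₂ := fun z => -F₂ z) h₁ h₂.neg hy hp
      (by rw [fderiv_fun_neg]; simpa using h) (by simpa using hz)
    filter_upwards [key] with z hz
    rw [hz, Left.sign_neg]
  · exact Or.inl (eventually_sign_eq_of_fderiv_pos h₁ h₂ hy hp h hz)

end Signs

section SignPatching

open Set Filter Topology

variable {X : Type*} [TopologicalSpace X]

/-- `s` agrees on `W`, locally and up to sign, with the family of local sign functions `σ`. -/
def IsLocalSignOn (σ : X → X → SignType) (s : X → SignType) (W : Set X) : Prop :=
  ∀ x ∈ W, s =ᶠ[𝓝 x] σ x ∨ s =ᶠ[𝓝 x] fun y => -σ x y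

theorem IsLocalSignOn.mono {σ : X → X → SignType} {s : X → SignType} {W W' : Set X}
    (h : IsLocalSignOn σ s W) (hW : W' ⊆ W) : IsLocalSignOn σ s W' :=
  fun x hx => h x (hW hx)

theorem IsLocalSignOn.neg {σ : X → X → SignType} {s : X → SignType} {W : Set X}
    (h : IsLocalSignOn σ s W) : IsLocalSignOn σ (fun y => -s y) W := by
  intro x hx
  rcases h x hx with h | h
  · exact Or.inr (h.fun_comp fun a => -a)
  · left
    filter_upwards [h] with y hy
    rw [hy, neg_neg]

theorem IsLocalSignOn.congr {σ : X → X → SignType} {s s' : X → SignType} {W : Set X}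
    (h : IsLocalSignOn σ s W) (hW : IsOpen W) (hs : EqOn s' s W) : IsLocalSignOn σ s' W := by
  intro x hx
  have : s' =ᶠ[𝓝 x] s := Filter.eventually_of_mem (hW.mem_nhds hx) hs
  exact (h x hx).imp this.trans this.trans

/-- On a preconnected open set, local sign functions are unique up to a global sign. -/
theorem IsLocalSignOn.eqOn_or_eqOn_neg {σ : X → X → SignType}
    (hσ : ∀ x, ∃ᶠ y in 𝓝 x, σ x y ≠ 0) {s s' : X → SignType} {W : Set X} (hW : IsOpen W)
    (hWc : IsPreconnected W) (hs : IsLocalSignOn σ s W) (hs' : IsLocalSignOn σ s' W) :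
    EqOn s s' W ∨ EqOn s (fun y => -s' y) W := by
  set A : Set X := {x | ∀ᶠ y in 𝓝 x, s y = s' y}
  set B : Set X := {x | ∀ᶠ y in 𝓝 x, s y = -s' y}
  have hA : IsOpen A := isOpen_setOfPred_eventually_nhds
  have hB : IsOpen B := isOpen_setOfPred_eventually_nhds
  have hcov : W ⊆ (A ∩ W) ∪ (B ∩ W) := by
    intro x hx
    rcases hs x hx with h | h <;> rcases hs' x hx with h' | h'
    · exact Or.inl ⟨h.trans h'.symm, hx⟩
    · refine Or.inr ⟨?_, hx⟩
      filter_upwards [h, h'] with y hy hy'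
      rw [hy, hy', neg_neg]
    · refine Or.inr ⟨?_, hx⟩
      filter_upwards [h, h'] with y hy hy'
      rw [hy, hy']
    · exact Or.inl ⟨h.trans h'.symm, hx⟩
  have hdisj : Disjoint (A ∩ W) (B ∩ W) := by
    rw [Set.disjoint_left]
    rintro x ⟨hxA, hxW⟩ ⟨hxB, -⟩
    refine hσ x ?_
    have hxA : ∀ᶠ y in 𝓝 x, s y = s' y := hxA
    have hxB : ∀ᶠ y in 𝓝 x, s y = -s' y := hxB
    have key : ∀ᶠ y in 𝓝 x, s y = 0 := by
      filter_upwards [hxA, hxB] with y h1 h2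
      rw [← h1] at h2
      revert h2
      generalize s y = a
      revert a
      decide
    rcases hs x hxW with h | h
    · filter_upwards [h, key] with y h1 h2
      simp [← h1, h2]
    · filter_upwards [h, key] with y h1 h2
      have : -σ x y = 0 := by rw [← h1, h2]
      simpa using this
  rcases hWc.subset_or_subset (hA.inter hW) (hB.inter hW) hdisj hcov with h | h
  · exact Or.inl fun x hx => (h hx).1.self_of_nhds
  · exact Or.inr fun x hx => (h hx).1.self_of_nhds

/-- Gluing local sign functions along a preconnected intersection. -/
theorem IsLocalSignOn.exists_union {σ : X → X → SignType}
    (hσ : ∀ x, ∃ᶠ y in 𝓝 x, σ x y ≠ 0) {s s' : X → SignType} {W W' : Set X} (hW : IsOpen W)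
    (hW' : IsOpen W') (hc : IsPreconnected (W ∩ W')) (hs : IsLocalSignOn σ s W)
    (hs' : IsLocalSignOn σ s' W') : ∃ s'', IsLocalSignOn σ s'' (W ∪ W') := by
  classical
  wlog heq : EqOn s s' (W ∩ W') generalizing s'
  · rcases IsLocalSignOn.eqOn_or_eqOn_neg hσ (hW.inter hW') hc (hs.mono inter_subset_left)
      (hs'.mono inter_subset_right) with h | h
    · exact absurd h heq
    · exact this hs'.neg h
  refine ⟨W.piecewise s s', ?_⟩
  rintro x (hx | hx)
  · exact hs.congr hW (W.piecewise_eqOn s s') x hx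
  · refine hs'.congr hW' (fun y hy => ?_) x hx
    by_cases hyW : y ∈ W
    · rw [W.piecewise_eq_of_mem _ _ hyW, heq ⟨hyW, hy⟩]
    · rw [W.piecewise_eq_of_notMem _ _ hyW]

variable {E : Type*} [NormedAddCommGroup E] [NormedSpace ℝ E]

/-- Any two points lie in a convex open set carrying a local sign function. -/
theorem exists_convex_isLocalSignOn {σ : E → E → SignType}
    (hσ : ∀ x, ∃ᶠ y in 𝓝 x, σ x y ≠ 0)
    (hloc : ∀ x, ∀ᶠ y in 𝓝 x, σ x =ᶠ[𝓝 y] σ y ∨ σ x =ᶠ[𝓝 y] fun z => -σ y z) (x : E) :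
    ∃ W : Set E, IsOpen W ∧ Convex ℝ W ∧ 0 ∈ W ∧ x ∈ W ∧ ∃ s, IsLocalSignOn σ s W := by
  let P : ℝ → ℝ → Prop := fun a b => ∃ W : Set E, IsOpen W ∧ Convex ℝ W ∧ a • x ∈ W ∧ b • x ∈ W ∧
    ∃ s, IsLocalSignOn σ s W
  have hP : P 0 1 := by
    refine isPreconnected_univ.induction₂ P ?_ ?_ ?_ (mem_univ 0) (mem_univ 1)
    · intro a _
      obtain ⟨r, hr, hball⟩ := Metric.eventually_nhds_iff_ball.1 (hloc (a • x))
      have hcont : Tendsto (fun b : ℝ => b • x) (𝓝 a) (𝓝 (a • x)) := by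
        exact (continuous_id.smul continuous_const).tendsto a
      rw [nhdsWithin_univ]
      filter_upwards [hcont (Metric.ball_mem_nhds _ hr)] with b hb
      exact ⟨Metric.ball (a • x) r, Metric.isOpen_ball, convex_ball _ _, Metric.mem_ball_self hr,
        hb, σ (a • x), hball⟩
    · rintro a b d - - - ⟨W, hWo, hWc, haW, hbW, s, hs⟩ ⟨W', hWo', hWc', hbW', hdW', s', hs'⟩
      obtain ⟨s'', hs''⟩ := IsLocalSignOn.exists_union hσ hWo hWo' (hWc.inter hWc').isPreconnected
        hs hs'
      have himg : ∀ V : Set E, Convex ℝ V → ∀ p q : ℝ, p • x ∈ V → q • x ∈ V →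
          ∀ t ∈ uIcc p q, t • x ∈ V := by
        intro V hV p q hp hq t ht
        have hV' : Convex ℝ ((LinearMap.toSpanSingleton ℝ E x) ⁻¹' V) := hV.linear_preimage _
        rw [← segment_eq_uIcc] at ht
        exact hV'.segment_subset (x := p) (y := q) hp hq ht
      have hK : IsCompact (segment ℝ (a • x) (d • x)) := by
        rw [segment_eq_image_lineMap]
        exact isCompact_Icc.image (by fun_prop)
      have hsub : segment ℝ (a • x) (d • x) ⊆ W ∪ W' := by
        have : segment ℝ (a • x) (d • x) = (LinearMap.toSpanSingleton ℝ E x) '' segment ℝ a d := by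
          have h := image_segment ℝ (LinearMap.toSpanSingleton ℝ E x).toAffineMap a d
          exact h.symm
        rw [this, segment_eq_uIcc]
        rintro _ ⟨t, ht, rfl⟩
        rcases uIcc_subset_uIcc_union_uIcc (b := b) ht with ht | ht
        · exact Or.inl (himg W hWc a b haW hbW t ht)
        · exact Or.inr (himg W' hWc' b d hbW' hdW' t ht)
      obtain ⟨δ, hδ, hδW⟩ := hK.exists_thickening_subset_open (hWo.union hWo') hsub
      exact ⟨Metric.thickening δ (segment ℝ (a • x) (d • x)), Metric.isOpen_thickening,
        (convex_segment _ _).thickening δ,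
        Metric.self_subset_thickening hδ _ (left_mem_segment _ _ _),
        Metric.self_subset_thickening hδ _ (right_mem_segment _ _ _), s'', hs''.mono hδW⟩
    · rintro a b - - ⟨W, hWo, hWc, haW, hbW, s, hs⟩
      exact ⟨W, hWo, hWc, hbW, haW, s, hs⟩
  simpa [P] using hP

/-- A compatible family of local sign functions on a normed space comes from a global one. -/
theorem exists_isLocalSignOn_univ {σ : E → E → SignType}
    (hσ : ∀ x, ∃ᶠ y in 𝓝 x, σ x y ≠ 0)
    (hloc : ∀ x, ∀ᶠ y in 𝓝 x, σ x =ᶠ[𝓝 y] σ y ∨ σ x =ᶠ[𝓝 y] fun z => -σ y z) :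
    ∃ s, IsLocalSignOn σ s univ := by
  have hnorm : ∀ x : E, ∃ W : Set E, IsOpen W ∧ Convex ℝ W ∧ 0 ∈ W ∧ x ∈ W ∧
      ∃ s, IsLocalSignOn σ s W ∧ s =ᶠ[𝓝 0] σ 0 := by
    intro x
    obtain ⟨W, hWo, hWc, h0, hx, s, hs⟩ := exists_convex_isLocalSignOn hσ hloc x
    refine ⟨W, hWo, hWc, h0, hx, ?_⟩
    rcases hs 0 h0 with h | h
    · exact ⟨s, hs, h⟩
    · refine ⟨_, hs.neg, ?_⟩
      filter_upwards [h] with y hy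
      rw [hy, neg_neg]
  choose W hWo hWc h0 hx s hs hs0 using hnorm
  refine ⟨fun x => s x x, fun x _ => ?_⟩
  refine (hs x).congr (hWo x) (fun y hy => ?_) x (hx x)
  rcases IsLocalSignOn.eqOn_or_eqOn_neg hσ ((hWo y).inter (hWo x))
    ((hWc y).inter (hWc x)).isPreconnected ((hs y).mono inter_subset_left)
    ((hs x).mono inter_subset_right) with h | h
  · exact h ⟨hx y, hy⟩
  · refine absurd ?_ (hσ 0)
    have hmem : W y ∩ W x ∈ 𝓝 (0 : E) := ((hWo y).inter (hWo x)).mem_nhds ⟨h0 y, h0 x⟩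
    filter_upwards [hs0 y, hs0 x, hmem] with z h1 h2 h3
    have h4 : s y z = -s x z := h h3
    rw [h1, h2] at h4
    change ¬ (σ 0 z ≠ 0)
    revert h4
    generalize σ 0 z = a
    revert a
    decide

end SignPatching

section DefiningFunction

open Set Filter Topology

/-- A function is smooth if it is smooth at the points of its topological support. -/
theorem contDiff_of_forall_mem_tsupport {E F : Type*} [NormedAddCommGroup E] [NormedSpace ℝ E]
    [NormedAddCommGroup F] [NormedSpace ℝ F] {m : WithTop ℕ∞} {f : E → F}
    (h : ∀ x ∈ tsupport f, ContDiffAt ℝ m f x) : ContDiff ℝ m f := by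
  refine contDiff_iff_contDiffAt.2 fun x => ?_
  by_cases hx : x ∈ tsupport f
  · exact h x hx
  · exact contDiffAt_const.congr_of_eventuallyEq (notMem_tsupport_iff_eventuallyEq.1 hx)

/-- A closed smooth hypersurface of `ℝ^n` is two-sided: its local defining functions can be chosen
with signs induced by a global function `s`. -/
theorem IsSmoothHypersurface.exists_sign {n : ℕ} {c : Set (EuclideanSpace ℝ (Fin n))}
    (hc : IsClosed c) (h : IsSmoothHypersurface c) :
    ∃ s : EuclideanSpace ℝ (Fin n) → SignType, (∀ y, s y = 0 ↔ y ∈ c) ∧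
      ∀ x ∈ c, ∃ (r : ℝ) (F : EuclideanSpace ℝ (Fin n) → ℝ), 0 < r ∧
        ContDiffOn ℝ (⊤ : ℕ∞) F (Metric.ball x r) ∧ (∀ y ∈ Metric.ball x r, fderiv ℝ F y ≠ 0) ∧
        ∀ y ∈ Metric.ball x r, s y = SignType.sign (F y) := by
  classical
  choose! U F hUo hxU hF hdF hcU using h
  have hzero : ∀ x ∈ c, ∀ y ∈ U x, F x y = 0 ↔ y ∈ c := by
    intro x hx y hy
    have := Set.ext_iff.1 (hcU x hx) y
    simp only [mem_inter_iff, mem_ofPred_eq] at this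
    tauto
  set σ : EuclideanSpace ℝ (Fin n) → EuclideanSpace ℝ (Fin n) → SignType := fun x =>
    if x ∈ c then fun y => SignType.sign (F x y) else fun _ => 1 with hσdef
  have σ_mem : ∀ x ∈ c, σ x = fun y => SignType.sign (F x y) := fun x hx => if_pos hx
  have σ_not : ∀ x ∉ c, σ x = fun _ => 1 := fun x hx => if_neg hx
  have hσ : ∀ x, ∃ᶠ y in 𝓝 x, σ x y ≠ 0 := by
    intro x
    by_cases hx : x ∈ c
    · rw [σ_mem x hx]
      intro hcon
      have : F x =ᶠ[𝓝 x] fun _ => (0 : ℝ) := by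
        filter_upwards [hcon] with y hy
        simpa using hy
      exact hdF x hx x (hxU x hx) (by rw [this.fderiv_eq]; simp)
    · rw [σ_not x hx]
      exact (Eventually.of_forall fun _ => one_ne_zero).frequently
  have hloc : ∀ x, ∀ᶠ y in 𝓝 x, σ x =ᶠ[𝓝 y] σ y ∨ σ x =ᶠ[𝓝 y] fun z => -σ y z := by
    intro x
    by_cases hx : x ∈ c
    · filter_upwards [(hUo x hx).mem_nhds (hxU x hx)] with y hy
      have hxy : ContDiffAt ℝ (⊤ : ℕ∞) (F x) y := (hF x hx).contDiffAt ((hUo x hx).mem_nhds hy)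
      by_cases hyc : y ∈ c
      · rw [σ_mem x hx, σ_mem y hyc]
        refine eventually_sign_eq_or_eq_neg (hxy.of_le (by simp))
          (((hF y hyc).contDiffAt ((hUo y hyc).mem_nhds (hxU y hyc))).of_le (by simp))
          ((hzero x hx y hy).2 hyc) (hdF x hx y hy) (hdF y hyc y (hxU y hyc)) ?_
        filter_upwards [(hUo x hx).mem_nhds hy, (hUo y hyc).mem_nhds (hxU y hyc)] with z hz hz'
        rw [hzero x hx z hz, hzero y hyc z hz']
      · rw [σ_mem x hx, σ_not y hyc]
        rcases lt_or_gt_of_ne (mt (hzero x hx y hy).1 hyc) with h0 | h0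
        · right
          filter_upwards [hxy.continuousAt.eventually_lt_const h0] with z hz
          rw [sign_neg hz]
        · left
          filter_upwards [hxy.continuousAt.eventually_const_lt h0] with z hz
          rw [sign_pos hz]
    · filter_upwards [hc.isOpen_compl.mem_nhds hx] with y hy
      left
      rw [σ_not x hx, σ_not y hy]
  obtain ⟨s, hs⟩ := exists_isLocalSignOn_univ hσ hloc
  refine ⟨s, fun y => ?_, fun x hx => ?_⟩
  · have hy0 : σ y y = 0 ↔ y ∈ c := by
      by_cases hy : y ∈ c
      · simp [σ_mem y hy, hy, hzero y hy y (hxU y hy)]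
      · simp [σ_not y hy, hy]
    rcases hs y (mem_univ y) with h | h
    · rw [h.self_of_nhds, hy0]
    · have h' : s y = -σ y y := h.self_of_nhds
      rw [h', ← hy0]
      generalize σ y y = a
      revert a
      decide
  · rcases hs x (mem_univ x) with h | h
    · rw [σ_mem x hx] at h
      obtain ⟨r, hr, hball⟩ := Metric.eventually_nhds_iff_ball.1
        (h.and ((hUo x hx).mem_nhds (hxU x hx)))
      exact ⟨r, F x, hr, (hF x hx).mono fun y hy => (hball y hy).2,
        fun y hy => hdF x hx y (hball y hy).2, fun y hy => (hball y hy).1⟩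
    · rw [σ_mem x hx] at h
      obtain ⟨r, hr, hball⟩ := Metric.eventually_nhds_iff_ball.1
        (h.and ((hUo x hx).mem_nhds (hxU x hx)))
      refine ⟨r, fun y => -F x y, hr, ((hF x hx).mono fun y hy => (hball y hy).2).neg,
        fun y hy => ?_, fun y hy => ?_⟩
      · rw [fderiv_fun_neg]
        exact neg_ne_zero.2 (hdF x hx y (hball y hy).2)
      · rw [(hball y hy).1, Left.sign_neg]

/-- A compact smooth hypersurface of `ℝ^n` is, near itself, the regular zero set of a compactly
supported smooth function. -/
theorem IsSmoothHypersurface.exists_definingFunction {n : ℕ} {c : Set (EuclideanSpace ℝ (Fin n))}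
    (hc : IsCompact c) (h : IsSmoothHypersurface c) :
    ∃ (G : EuclideanSpace ℝ (Fin n) → ℝ) (W : Set (EuclideanSpace ℝ (Fin n))),
      ContDiff ℝ (⊤ : ℕ∞) G ∧ HasCompactSupport G ∧ IsOpen W ∧ c ⊆ W ∧
      (∀ y ∈ W, fderiv ℝ G y ≠ 0) ∧ ∀ y ∈ W, G y = 0 ↔ y ∈ c := by
  obtain ⟨s, hs0, hs⟩ := h.exists_sign hc.isClosed
  choose! r F hr hF hdF hsF using hs
  have hbump : ∀ x, ∃ ρ : EuclideanSpace ℝ (Fin n) → ℝ, x ∈ c →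
      ContDiff ℝ (⊤ : ℕ∞) ρ ∧ (∀ y, 0 ≤ ρ y) ∧ (∀ y ∈ Metric.ball x (r x / 4), ρ y = 1) ∧
      tsupport ρ = Metric.closedBall x (r x / 2) := by
    intro x
    by_cases hx : x ∈ c
    · let f : ContDiffBump x := ⟨r x / 4, r x / 2, by linarith [hr x hx], by linarith [hr x hx]⟩
      exact ⟨f, fun _ => ⟨f.contDiff, fun y => f.nonneg,
        fun y hy => f.one_of_mem_closedBall (Metric.ball_subset_closedBall hy), f.tsupport_eq⟩⟩
    · exact ⟨0, fun h => absurd h hx⟩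
  choose ρ hρ using hbump
  set g : EuclideanSpace ℝ (Fin n) → EuclideanSpace ℝ (Fin n) → ℝ := fun x y => ρ x y * F x y
    with hg
  have htsub : ∀ x ∈ c, tsupport (ρ x) ⊆ Metric.ball x (r x) := by
    intro x hx
    rw [(hρ x hx).2.2.2]
    exact Metric.closedBall_subset_ball (by linarith [hr x hx])
  have hgsupp : ∀ x, tsupport (g x) ⊆ tsupport (ρ x) := fun x => tsupport_mul_subset_left
  have hgsmooth : ∀ x ∈ c, ContDiff ℝ (⊤ : ℕ∞) (g x) := by
    intro x hx
    refine contDiff_of_forall_mem_tsupport fun y hy => ?_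
    have hyb := htsub x hx (hgsupp x hy)
    exact (hρ x hx).1.contDiffAt.mul ((hF x hx).contDiffAt (Metric.isOpen_ball.mem_nhds hyb))
  have hgcpt : ∀ x ∈ c, HasCompactSupport (g x) := by
    intro x hx
    have : HasCompactSupport (ρ x) := by
      rw [HasCompactSupport, (hρ x hx).2.2.2]
      exact isCompact_closedBall _ _
    exact this.mul_right
  have hg0 : ∀ x ∈ c, ∀ y ∈ c, g x y = 0 := by
    intro x hx y hy
    by_cases hyx : y ∈ Metric.ball x (r x)
    · have := (hsF x hx y hyx).symm.trans ((hs0 y).2 hy)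
      simp [hg, sign_eq_zero_iff.1 this]
    · have : ρ x y = 0 := image_eq_zero_of_notMem_tsupport fun h => hyx (htsub x hx h)
      simp [hg, this]
  have hgnonneg : ∀ x ∈ c, ∀ y, 0 ≤ (s y : ℝ) * g x y := by
    intro x hx y
    by_cases hyx : y ∈ Metric.ball x (r x)
    · rw [hsF x hx y hyx, hg, mul_left_comm, sign_mul_self]
      exact mul_nonneg ((hρ x hx).2.1 y) (abs_nonneg _)
    · have : ρ x y = 0 := image_eq_zero_of_notMem_tsupport fun h => hyx (htsub x hx h)
      simp [hg, this]
  have hgpos : ∀ x ∈ c, ∀ y ∈ Metric.ball x (r x / 4), y ∉ c → 0 < (s y : ℝ) * g x y := by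
    intro x hx y hy hyc
    have hyx : y ∈ Metric.ball x (r x) :=
      Metric.ball_subset_ball (by linarith [hr x hx]) hy
    refine lt_of_le_of_ne (hgnonneg x hx y) (Ne.symm (mul_ne_zero ?_ ?_))
    · have := mt (hs0 y).1 hyc
      revert this
      generalize s y = a
      revert a
      intro a ha
      cases a <;> simp_all
    · have h1 : F x y ≠ 0 := by
        intro h0
        refine hyc ((hs0 y).1 ?_)
        rw [hsF x hx y hyx, h0, _root_.sign_zero]
      simp [hg, (hρ x hx).2.2.1 y hy, h1]
  obtain ⟨t, htc, htcov⟩ := hc.elim_nhds_subcover (fun x => Metric.ball x (r x / 4))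
    fun x hx => Metric.ball_mem_nhds x (by linarith [hr x hx])
  set G : EuclideanSpace ℝ (Fin n) → ℝ := fun y => ∑ x ∈ t, g x y with hG
  have hGsmooth : ContDiff ℝ (⊤ : ℕ∞) G := ContDiff.sum fun x hx => hgsmooth x (htc x hx)
  set W₀ : Set (EuclideanSpace ℝ (Fin n)) := ⋃ x ∈ t, Metric.ball x (r x / 4) with hW₀
  have hdG : ∀ y ∈ c, fderiv ℝ G y ≠ 0 := by
    intro y hy
    obtain ⟨x, hxt, hyx⟩ := mem_iUnion₂.1 (htcov hy)
    have hx := htc x hxt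
    have hyx' : y ∈ Metric.ball x (r x) :=
      Metric.ball_subset_ball (by linarith [hr x hx]) hyx
    have hgd : ∀ z ∈ c, DifferentiableAt ℝ (g z) y := fun z hz =>
      (hgsmooth z hz).contDiffAt.differentiableAt (by simp)
    have hgx : fderiv ℝ (g x) y ≠ 0 := by
      have : g x =ᶠ[𝓝 y] F x := by
        filter_upwards [Metric.isOpen_ball.mem_nhds hyx] with z hz
        simp [hg, (hρ x hx).2.2.1 z hz]
      rw [this.fderiv_eq]
      exact hdF x hx y hyx'
    obtain ⟨v, hv⟩ : ∃ v, 0 < fderiv ℝ (g x) y v := by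
      obtain ⟨v, hv⟩ := DFunLike.ne_iff.1 hgx
      rw [zero_apply] at hv
      rcases lt_or_gt_of_ne hv with h0 | h0
      · exact ⟨-v, by simpa using h0⟩
      · exact ⟨v, h0⟩
    have hline : ∀ z ∈ c, HasDerivAt (fun τ : ℝ => g z (y + τ • v)) (fderiv ℝ (g z) y v) 0 := by
      intro z hz
      have h1 : HasDerivAt (fun τ : ℝ => y + τ • v) v 0 := by
        simpa using ((hasDerivAt_id (0 : ℝ)).smul_const v).const_add y
      have h2 : HasFDerivAt (g z) (fderiv ℝ (g z) y) (y + (0 : ℝ) • v) := by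
        simpa using (hgd z hz).hasFDerivAt
      exact h2.comp_hasDerivAt (0 : ℝ) h1
    have hslope : ∀ z ∈ c, Tendsto (fun τ : ℝ => τ⁻¹ * g z (y + τ • v)) (𝓝[>] 0)
        (𝓝 (fderiv ℝ (g z) y v)) := by
      intro z hz
      have := (hline z hz).tendsto_slope_zero_right
      simpa [hg0 z hz y hy] using this
    have hsv : ∀ᶠ τ : ℝ in 𝓝[>] 0, s (y + τ • v) = 1 := by
      have hball : ∀ᶠ τ : ℝ in 𝓝[>] 0, y + τ • v ∈ Metric.ball x (r x / 4) := by
        have hcont : Tendsto (fun τ : ℝ => y + τ • v) (𝓝 0) (𝓝 (y + (0 : ℝ) • v)) :=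
          (by fun_prop : Continuous fun τ : ℝ => y + τ • v).tendsto 0
        rw [zero_smul, add_zero] at hcont
        exact nhdsWithin_le_nhds (hcont (Metric.isOpen_ball.mem_nhds hyx))
      filter_upwards [(hslope x hx).eventually_const_lt hv, hball, self_mem_nhdsWithin]
        with τ h1 h2 h3
      have h4 : 0 < g x (y + τ • v) := (mul_pos_iff_of_pos_left (inv_pos.2 h3)).1 h1
      rw [hsF x hx _ (Metric.ball_subset_ball (by linarith [hr x hx]) h2)]
      have h5 : 0 < F x (y + τ • v) := by simpa [hg, (hρ x hx).2.2.1 _ h2] using h4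
      exact sign_pos h5
    have hnonneg : ∀ z ∈ c, 0 ≤ fderiv ℝ (g z) y v := by
      intro z hz
      refine ge_of_tendsto (hslope z hz) ?_
      filter_upwards [hsv, self_mem_nhdsWithin] with τ h1 h2
      have h3 := hgnonneg z hz (y + τ • v)
      rw [h1] at h3
      simp only [SignType.coe_one, one_mul] at h3
      exact mul_nonneg (inv_nonneg.2 (le_of_lt h2)) h3
    intro hcon
    have hsum : fderiv ℝ G y v = ∑ z ∈ t, fderiv ℝ (g z) y v := by
      rw [hG, fderiv_fun_sum fun z hz => hgd z (htc z hz)]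
      simp
    have : 0 < fderiv ℝ G y v := by
      rw [hsum]
      exact Finset.sum_pos' (fun z hz => hnonneg z (htc z hz)) ⟨x, hxt, hv⟩
    rw [hcon] at this
    simp at this
  refine ⟨G, W₀ ∩ {y | fderiv ℝ G y ≠ 0}, hGsmooth, ?_, ?_, ?_, fun y hy => hy.2, ?_⟩
  · refine HasCompactSupport.of_support_subset_isCompact
      (t.isCompact_biUnion fun x hx => hgcpt x (htc x hx)) fun y hy => ?_
    obtain ⟨x, hx, hxy⟩ := Finset.exists_ne_zero_of_sum_ne_zero hy
    exact mem_iUnion₂.2 ⟨x, hx, subset_tsupport _ hxy⟩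
  · refine (isOpen_biUnion fun x _ => Metric.isOpen_ball).inter ?_
    exact isOpen_ne_fun (hGsmooth.continuous_fderiv (by simp)) continuous_const
  · exact fun y hy => ⟨htcov hy, hdG y hy⟩
  · rintro y ⟨hyW, -⟩
    refine ⟨fun hGy => ?_, fun hy => Finset.sum_eq_zero fun x hx => hg0 x (htc x hx) y hy⟩
    by_contra hyc
    obtain ⟨x, hxt, hyx⟩ := mem_iUnion₂.1 hyW
    have : 0 < (s y : ℝ) * G y := by
      rw [hG, Finset.mul_sum]
      exact Finset.sum_pos' (fun z hz => hgnonneg z (htc z hz) y)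
        ⟨x, hxt, hgpos x (htc x hxt) y hyx hyc⟩
    simp [hGy] at this

end DefiningFunction

section Straightening

open Set Filter Topology
open scoped Manifold ContDiff

/-- Smooth cutoff functions near a compact set. -/
theorem exists_contDiff_eventually_eq_one {X : Type*} [NormedAddCommGroup X] [NormedSpace ℝ X]
    [FiniteDimensional ℝ X] {K R : Set X} (hK : IsCompact K) (hR : IsOpen R) (hKR : K ⊆ R) :
    ∃ χ : X → ℝ, ContDiff ℝ (⊤ : ℕ∞) χ ∧ HasCompactSupport χ ∧ tsupport χ ⊆ R ∧
      ∀ᶠ x in 𝓝ˢ K, χ x = 1 := by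
  obtain ⟨L, hL, hKL, hLR⟩ := exists_compact_between hK hR hKR
  obtain ⟨f, hf1, hf0, -⟩ :=
    exists_contMDiffMap_one_nhds_of_subset_interior (n := (⊤ : ℕ∞)) 𝓘(ℝ, X) hK.isClosed hKL
  have hsub : tsupport f ⊆ L :=
    closure_minimal (fun x hx => by_contra fun hxL => hx (hf0 x hxL)) hL.isClosed
  exact ⟨f, contMDiff_iff_contDiff.1 f.contMDiff, hL.of_isClosed_subset (isClosed_tsupport _) hsub,
    hsub.trans hLR, hf1⟩

/-- An injective smooth map with invertible derivatives on an open set has a smooth inverse. -/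
theorem exists_contDiffOn_inverse {X Y : Type*} [NormedAddCommGroup X] [NormedSpace ℝ X]
    [CompleteSpace X] [NormedAddCommGroup Y] [NormedSpace ℝ Y] {Q : X → Y} {Ω : Set X}
    (hΩ : IsOpen Ω) (hQ : ContDiff ℝ (⊤ : ℕ∞) Q)
    (hd : ∀ p ∈ Ω, ∃ e : X ≃L[ℝ] Y, HasFDerivAt Q (e : X →L[ℝ] Y) p) (hinj : InjOn Q Ω) :
    ∃ H : Y → X, IsOpen (Q '' Ω) ∧ ContDiffOn ℝ (⊤ : ℕ∞) H (Q '' Ω) ∧ ∀ p ∈ Ω, H (Q p) = p := by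
  classical
  rcases isEmpty_or_nonempty X with hX | hX
  · exact ⟨fun _ => 0, by simp [Set.eq_empty_of_isEmpty], contDiffOn_const,
      fun p => isEmptyElim p⟩
  have hleft : ∀ p ∈ Ω, Function.invFunOn Q Ω (Q p) = p := fun p hp =>
    hinj.leftInvOn_invFunOn hp
  have key : ∀ p ∈ Ω, ∃ g : Y → X, ContDiffAt ℝ (⊤ : ℕ∞) g (Q p) ∧
      ∀ᶠ q in 𝓝 (Q p), g q ∈ Ω ∧ Q (g q) = q := by
    intro p hp
    obtain ⟨e, he⟩ := hd p hp
    have hQp : ContDiffAt ℝ (⊤ : ℕ∞) Q p := hQ.contDiffAt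
    have hg := hQp.to_localInverse he (by simp)
    refine ⟨hQp.localInverse he (by simp), hg, ?_⟩
    have h1 := hg.continuousAt.preimage_mem_nhds (t := Ω)
      (by rw [hQp.localInverse_apply_image he (by simp)]; exact hΩ.mem_nhds hp)
    filter_upwards [h1, (hQp.hasStrictFDerivAt' he (by simp)).eventually_right_inverse]
      with q hq hq'
    exact ⟨hq, hq'⟩
  refine ⟨Function.invFunOn Q Ω, ?_, ?_, hleft⟩
  · rw [isOpen_iff_mem_nhds]
    rintro _ ⟨p, hp, rfl⟩
    obtain ⟨g, -, hg⟩ := key p hp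
    filter_upwards [hg] with q hq
    exact ⟨g q, hq.1, hq.2⟩
  · rintro _ ⟨p, hp, rfl⟩
    obtain ⟨g, hg, hgq⟩ := key p hp
    refine (hg.congr_of_eventuallyEq ?_).contDiffWithinAt
    filter_upwards [hgq] with q hq
    rw [← hleft _ hq.1, hq.2]

/-- Near a compact set of regular points, the value of `G` can be shifted by any small amount `d`
through a displacement depending smoothly on the point and on `d`. -/
theorem exists_straightening {E : Type*} [NormedAddCommGroup E] [InnerProductSpace ℝ E]
    [FiniteDimensional ℝ E] {G : E → ℝ} (hG : ContDiff ℝ (⊤ : ℕ∞) G) {c : Set E}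
    (hc : IsCompact c) (hd : ∀ y ∈ c, fderiv ℝ G y ≠ 0) :
    ∃ P : E × ℝ → E, ContDiff ℝ (⊤ : ℕ∞) P ∧ HasCompactSupport P ∧ (∀ y, P (y, 0) = 0) ∧
      ∃ (N : Set E) (δ : ℝ), IsOpen N ∧ c ⊆ N ∧ 0 < δ ∧
        ∀ y ∈ N, ∀ d : ℝ, |d| < δ → G (y + P (y, d)) = G y + d := by
  have : CompleteSpace E := FiniteDimensional.complete ℝ E
  set v : E → E := fun y => (InnerProductSpace.toDual ℝ E).symm (fderiv ℝ G y) with hv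
  have hvs : ContDiff ℝ (⊤ : ℕ∞) v :=
    (InnerProductSpace.toDual ℝ E).symm.toContinuousLinearEquiv.contDiff.comp
      (hG.fderiv_right (m := (⊤ : ℕ∞)) (by simp))
  set q : E × ℝ → ℝ := fun p => G (p.1 + p.2 • v p.1) - G p.1 with hq
  have hqs : ContDiff ℝ (⊤ : ℕ∞) q :=
    (hG.comp (contDiff_fst.add (contDiff_snd.smul (hvs.comp contDiff_fst)))).sub
      (hG.comp contDiff_fst)
  have hqd : ∀ p, HasFDerivAt q (fderiv ℝ q p) p := fun p =>
    (hqs.contDiffAt.differentiableAt (by simp)).hasFDerivAt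
  have hqline : ∀ y s, HasDerivAt (fun s => q (y, s)) (fderiv ℝ q (y, s) (0, 1)) s := fun y s =>
    (hqd (y, s)).comp_hasDerivAt s ((hasDerivAt_const s y).prodMk (hasDerivAt_id s))
  have hq0 : ∀ y, q (y, 0) = 0 := fun y => by simp [hq]
  have hqpos : ∀ y ∈ c, 0 < fderiv ℝ q (y, 0) (0, 1) := by
    intro y hy
    have h1 : HasDerivAt (fun s : ℝ => y + s • v y) (v y) 0 := by
      simpa using ((hasDerivAt_id (0 : ℝ)).smul_const (v y)).const_add y
    have h2 : HasFDerivAt G (fderiv ℝ G y) (y + (0 : ℝ) • v y) := by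
      simpa using (hG.contDiffAt.differentiableAt (by simp)).hasFDerivAt
    have h3 := (h2.comp_hasDerivAt (0 : ℝ) h1).sub_const (G y)
    rw [(hqline y 0).unique h3]
    have h4 : fderiv ℝ G y (v y) = inner ℝ (v y) (v y) := by
      rw [hv, InnerProductSpace.toDual_symm_apply]
    rw [h4, real_inner_self_pos]
    simpa [hv] using hd y hy
  set O : Set (E × ℝ) := {p | 0 < fderiv ℝ q p (0, 1)} with hO
  have hOo : IsOpen O := isOpen_lt continuous_const
    ((hqs.continuous_fderiv (by simp)).clm_apply continuous_const)
  obtain ⟨N, v₀, hN, hv₀, hcN, h0v₀, hNO⟩ := generalized_tube_lemma hc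
    (isCompact_singleton (x := (0 : ℝ))) hOo (by
      rintro ⟨y, s⟩ ⟨hy, rfl⟩
      exact hqpos y hy)
  obtain ⟨η, hη, hηv⟩ := Metric.isOpen_iff.1 hv₀ 0 (h0v₀ rfl)
  set Ω : Set (E × ℝ) := N ×ˢ Metric.ball 0 η with hΩ
  have hΩo : IsOpen Ω := hN.prod Metric.isOpen_ball
  have hΩO : Ω ⊆ O := (prod_mono le_rfl hηv).trans hNO
  set Q : E × ℝ → E × ℝ := fun p => (p.1, q p) with hQ
  have hQs : ContDiff ℝ (⊤ : ℕ∞) Q := contDiff_fst.prodMk hqs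
  have hQd : ∀ p ∈ Ω, ∃ e : (E × ℝ) ≃L[ℝ] (E × ℝ), HasFDerivAt Q (e : E × ℝ →L[ℝ] E × ℝ) p := by
    intro p hp
    set A : E × ℝ →L[ℝ] E × ℝ := (ContinuousLinearMap.fst ℝ E ℝ).prod (fderiv ℝ q p) with hA
    have hinj : Function.Injective A := by
      rw [injective_iff_map_eq_zero]
      rintro ⟨a, b⟩ hab
      obtain ⟨rfl, hb⟩ := Prod.mk_inj.1 (show (a, fderiv ℝ q p (a, b)) = (0, 0) from hab)
      have h1 : ((0 : E), b) = b • ((0 : E), (1 : ℝ)) := by simp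
      rw [h1, map_smul, smul_eq_mul] at hb
      rcases mul_eq_zero.1 hb with rfl | hb
      · rfl
      · exact absurd hb (hΩO hp).ne'
    refine ⟨(LinearEquiv.ofInjectiveEndo (A : E × ℝ →ₗ[ℝ] E × ℝ)
      hinj).toContinuousLinearEquiv, ?_⟩
    exact hasFDerivAt_fst.prodMk (hqd p)
  have hQinj : InjOn Q Ω := by
    rintro ⟨y, s⟩ ⟨hy, hs⟩ ⟨y', s'⟩ ⟨-, hs'⟩ heq
    obtain ⟨rfl, hqq⟩ := Prod.mk_inj.1 heq
    have hmono : StrictMonoOn (fun s => q (y, s)) (Metric.ball 0 η) := by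
      refine strictMonoOn_of_deriv_pos (convex_ball _ _)
        (fun t _ => (hqline y t).continuousAt.continuousWithinAt) fun t ht => ?_
      rw [(hqline y t).deriv]
      exact hΩO ⟨hy, interior_subset ht⟩
    exact congrArg (Prod.mk y) (hmono.injOn hs hs' hqq)
  obtain ⟨H, hRo, hHs, hHQ⟩ := exists_contDiffOn_inverse hΩo hQs hQd hQinj
  have hcR : c ×ˢ {(0 : ℝ)} ⊆ Q '' Ω := by
    rintro ⟨y, s⟩ ⟨hy, rfl⟩
    exact ⟨(y, 0), ⟨hcN hy, Metric.mem_ball_self hη⟩, by simp [hQ, hq0]⟩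
  obtain ⟨χ, hχs, hχc, hχR, hχ1⟩ := exists_contDiff_eventually_eq_one
    (hc.prod isCompact_singleton) hRo hcR
  obtain ⟨U, hUo, hcU, hU1⟩ := eventually_nhdsSet_iff_exists.1 hχ1
  obtain ⟨N', w, hN', hw, hcN', h0w, hNU⟩ := generalized_tube_lemma hc
    (isCompact_singleton (x := (0 : ℝ))) hUo hcU
  obtain ⟨δ, hδ, hδw⟩ := Metric.isOpen_iff.1 hw 0 (h0w rfl)
  refine ⟨fun p => χ p • ((H p).2 • v p.1), ?_, hχc.smul_right, ?_, N', δ, hN', hcN', hδ, ?_⟩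
  · refine contDiff_of_forall_mem_tsupport fun p hp => ?_
    have hpR := hχR (tsupport_smul_subset_left χ _ hp)
    exact hχs.contDiffAt.smul ((contDiff_snd.contDiffAt.comp p
      (hHs.contDiffAt (hRo.mem_nhds hpR))).smul (hvs.comp contDiff_fst).contDiffAt)
  · intro y
    by_cases hy : (y, (0 : ℝ)) ∈ tsupport χ
    · obtain ⟨⟨y', s⟩, ⟨hy', hs⟩, heq⟩ := hχR hy
      obtain ⟨rfl, -⟩ := Prod.mk_inj.1 heq
      have := hHQ (y', 0) ⟨hy', Metric.mem_ball_self hη⟩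
      simp only [hQ, hq0] at this
      simp [this]
    · simp [image_eq_zero_of_notMem_tsupport hy]
  · intro y hy d hdδ
    have h1 : χ (y, d) = 1 := hU1 _ (hNU ⟨hy, hδw (by simpa using hdδ)⟩)
    have hmem : (y, d) ∈ tsupport χ := subset_tsupport _ (by simp [h1])
    obtain ⟨⟨y', s⟩, hp, heq⟩ := hχR hmem
    obtain ⟨rfl, hqd⟩ := Prod.mk_inj.1 heq
    have h2 := hHQ (y', s) hp
    rw [heq] at h2
    simp only [h1, h2, one_smul]
    rw [← hqd]
    simp [hq]

end Straightening

section Approximation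

open Set Filter Topology

theorem analyticOnNhd_integral_pow_mul {n : ℕ} (ρ : ℝ) (k : ℕ)
    {g : EuclideanSpace ℝ (Fin n) → ℝ} (hg : Continuous g) (hgc : HasCompactSupport g) :
    AnalyticOnNhd ℝ (fun x => ∫ y, (ρ - ‖x - y‖ ^ 2) ^ k * g y) univ := by
  induction k generalizing g with
  | zero => simpa using analyticOnNhd_const
  | succ k ih =>
    have hintegrable : ∀ (h : EuclideanSpace ℝ (Fin n) → ℝ), Continuous h → HasCompactSupport h →
        ∀ x, Integrable fun y => (ρ - ‖x - y‖ ^ 2) ^ k * h y := fun h hh hhc x =>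
      (by fun_prop : Continuous fun y => (ρ - ‖x - y‖ ^ 2) ^ k * h y).integrable_of_hasCompactSupport
        hhc.mul_left
    have hcoord : ∀ i : Fin n, Continuous fun y : EuclideanSpace ℝ (Fin n) => y i * g y := fun i => by
      fun_prop
    have hcoordc : ∀ i : Fin n, HasCompactSupport fun y : EuclideanSpace ℝ (Fin n) => y i * g y :=
      fun i => hgc.mul_left
    have hsq : Continuous fun y : EuclideanSpace ℝ (Fin n) => ‖y‖ ^ 2 * g y := by fun_prop
    have hsqc : HasCompactSupport fun y : EuclideanSpace ℝ (Fin n) => ‖y‖ ^ 2 * g y := hgc.mul_left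
    have hexp : ∀ x y : EuclideanSpace ℝ (Fin n), (ρ - ‖x - y‖ ^ 2) ^ (k + 1) * g y =
        (ρ - ∑ i, x i ^ 2) * ((ρ - ‖x - y‖ ^ 2) ^ k * g y) +
          ∑ i, 2 * x i * ((ρ - ‖x - y‖ ^ 2) ^ k * (y i * g y)) -
          (ρ - ‖x - y‖ ^ 2) ^ k * (‖y‖ ^ 2 * g y) := by
      intro x y
      have h1 : ‖x - y‖ ^ 2 = ∑ i, x i ^ 2 - 2 * ∑ i, x i * y i + ‖y‖ ^ 2 := by
        rw [norm_sub_sq_real, EuclideanSpace.real_norm_sq_eq x, PiLp.inner_apply]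
        simp [mul_comm]
      have h2 : ∑ i, 2 * x i * ((ρ - ‖x - y‖ ^ 2) ^ k * (y i * g y)) =
          2 * (∑ i, x i * y i) * ((ρ - ‖x - y‖ ^ 2) ^ k * g y) := by
        rw [Finset.mul_sum, Finset.sum_mul]
        exact Finset.sum_congr rfl fun i _ => by ring
      rw [h2, pow_succ]
      linear_combination (-(ρ - ‖x - y‖ ^ 2) ^ k * g y) * h1
    have hproj : ∀ i : Fin n, AnalyticOnNhd ℝ (fun x : EuclideanSpace ℝ (Fin n) => x i) univ :=
      fun i x _ => (EuclideanSpace.proj (𝕜 := ℝ) i).analyticAt x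
    have heq : (fun x => ∫ y, (ρ - ‖x - y‖ ^ 2) ^ (k + 1) * g y) = fun x =>
        (ρ - ∑ i, x i ^ 2) * (∫ y, (ρ - ‖x - y‖ ^ 2) ^ k * g y) +
          ∑ i, 2 * x i * (∫ y, (ρ - ‖x - y‖ ^ 2) ^ k * (y i * g y)) -
          ∫ y, (ρ - ‖x - y‖ ^ 2) ^ k * (‖y‖ ^ 2 * g y) := by
      funext x
      simp_rw [hexp x]
      have i₁ := (hintegrable g hg hgc x).const_mul (ρ - ∑ i, x i ^ 2)
      have i₂ : ∀ i ∈ Finset.univ, Integrable fun y =>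
          2 * x i * ((ρ - ‖x - y‖ ^ 2) ^ k * (y i * g y)) := fun i _ =>
        (hintegrable _ (hcoord i) (hcoordc i) x).const_mul _
      have i₃ := integrable_finsetSum _ i₂
      have i₄ : Integrable fun y => (ρ - ∑ i, x i ^ 2) * ((ρ - ‖x - y‖ ^ 2) ^ k * g y) +
          ∑ i, 2 * x i * ((ρ - ‖x - y‖ ^ 2) ^ k * (y i * g y)) := i₁.add i₃
      rw [integral_sub i₄ (hintegrable _ hsq hsqc x), integral_add i₁ i₃, integral_finsetSum _ i₂,
        integral_const_mul]
      simp_rw [integral_const_mul]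
    rw [heq]
    refine ((AnalyticOnNhd.mul ?_ (ih hg hgc)).add ?_).sub (ih hsq hsqc)
    · exact analyticOnNhd_const.sub
        (Finset.univ.analyticOnNhd_fun_sum fun i _ => (hproj i).pow 2)
    · exact Finset.univ.analyticOnNhd_fun_sum fun i _ =>
        (analyticOnNhd_const.mul (hproj i)).mul (ih (hcoord i) (hcoordc i))

/-- The Landau averages of a Lipschitz function converge to it uniformly. -/
theorem eventually_norm_average_sub_le {E F : Type*} [NormedAddCommGroup E] [NormedSpace ℝ E]
    [FiniteDimensional ℝ E] [MeasurableSpace E] [BorelSpace E] (μ : Measure E) [μ.IsAddHaarMeasure]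
    [NormedAddCommGroup F] [NormedSpace ℝ F] [CompleteSpace F]
    {ρ : ℝ} (hρ : 0 < ρ) {h : E → F} {K : NNReal} (hh : LipschitzWith K h) {δ : ℝ} (hδ : 0 < δ) :
    ∀ᶠ k : ℕ in atTop, ∀ x, ‖(∫ z in Metric.closedBall (0 : E) ρ, (ρ ^ 2 - ‖z‖ ^ 2) ^ k ∂μ)⁻¹ •
      (∫ z in Metric.closedBall (0 : E) ρ, (ρ ^ 2 - ‖z‖ ^ 2) ^ k • h (x - z) ∂μ) - h x‖ ≤ δ := by
  have : ProperSpace E := FiniteDimensional.proper ℝ E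
  set B : Set E := Metric.closedBall 0 ρ
  have hB : IsCompact B := isCompact_closedBall _ _
  have hpos : ∀ z ∈ B, 0 ≤ ρ ^ 2 - ‖z‖ ^ 2 := by
    intro z hz
    have : ‖z‖ ≤ ρ := by simpa [B] using hz
    nlinarith [norm_nonneg z]
  have lim : ∀ g : E → ℝ, Continuous g → Tendsto (fun k : ℕ =>
      (∫ z in B, (ρ ^ 2 - ‖z‖ ^ 2) ^ k ∂μ)⁻¹ • ∫ z in B, (ρ ^ 2 - ‖z‖ ^ 2) ^ k • g z ∂μ)
      atTop (𝓝 (g 0)) := by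
    intro g hg
    refine tendsto_setIntegral_pow_smul_of_unique_maximum_of_isCompact_of_continuousOn hB
      (by fun_prop) (fun y _ hy => ?_) hpos (by simpa using pow_pos hρ 2) ?_ hg.continuousOn
    · have : 0 < ‖y‖ := norm_pos_iff.2 hy
      simp only [norm_zero]
      nlinarith
    · refine subset_closure (interior_mono Metric.ball_subset_closedBall ?_)
      rw [Metric.isOpen_ball.interior_eq]
      exact Metric.mem_ball_self hρ
  have l₁ := lim (fun _ => 1) continuous_const
  have l₂ := lim (fun z => K * ‖z‖) (by fun_prop)
  simp only [norm_zero, mul_zero] at l₂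
  filter_upwards [l₁.eventually_ne one_ne_zero, l₂.eventually_le_const hδ] with k hk₁ hk₂ x
  set I : ℝ := ∫ z in B, (ρ ^ 2 - ‖z‖ ^ 2) ^ k ∂μ with hI
  have hI0 : I ≠ 0 := by
    intro h0
    simp [← hI, h0] at hk₁
  have hInn : 0 ≤ I⁻¹ :=
    inv_nonneg.2 (setIntegral_nonneg measurableSet_closedBall fun z hz => pow_nonneg (hpos z hz) k)
  have hcont := hh.continuous
  have i₁ : IntegrableOn (fun z => (ρ ^ 2 - ‖z‖ ^ 2) ^ k • h (x - z)) B μ :=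
    (by fun_prop : Continuous fun z => (ρ ^ 2 - ‖z‖ ^ 2) ^ k • h (x - z)).continuousOn
      |>.integrableOn_compact hB
  have i₂ : IntegrableOn (fun z => (ρ ^ 2 - ‖z‖ ^ 2) ^ k • h x) B μ :=
    (by fun_prop : Continuous fun z : E => (ρ ^ 2 - ‖z‖ ^ 2) ^ k • h x).continuousOn
      |>.integrableOn_compact hB
  have i₃ : IntegrableOn (fun z => (ρ ^ 2 - ‖z‖ ^ 2) ^ k • (K * ‖z‖)) B μ :=
    (by fun_prop : Continuous fun z : E => (ρ ^ 2 - ‖z‖ ^ 2) ^ k • (K * ‖z‖)).continuousOn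
      |>.integrableOn_compact hB
  have h₁ : h x = I⁻¹ • ∫ z in B, (ρ ^ 2 - ‖z‖ ^ 2) ^ k • h x ∂μ := by
    rw [integral_smul_const, ← hI, inv_smul_smul₀ hI0]
  nth_rw 1 [h₁]
  rw [← smul_sub, ← integral_sub i₁ i₂, norm_smul, Real.norm_of_nonneg hInn]
  refine le_trans (mul_le_mul_of_nonneg_left ?_ hInn) hk₂
  refine (norm_integral_le_integral_norm _).trans ?_
  refine setIntegral_mono_on (i₁.sub i₂).norm i₃ measurableSet_closedBall fun z hz => ?_
  rw [← smul_sub, norm_smul, Real.norm_of_nonneg (pow_nonneg (hpos z hz) k), smul_eq_mul]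
  refine mul_le_mul_of_nonneg_left ?_ (pow_nonneg (hpos z hz) k)
  simpa using hh.norm_sub_le (x - z) x

/-- Analytic approximation in the `C^1` topology on balls. -/
theorem exists_analytic_approximation {n : ℕ} {G : EuclideanSpace ℝ (Fin n) → ℝ}
    (hG : ContDiff ℝ (⊤ : ℕ∞) G) (hGc : HasCompactSupport G) (R : ℝ) {δ : ℝ} (hδ : 0 < δ) :
    ∃ F : EuclideanSpace ℝ (Fin n) → ℝ, AnalyticOnNhd ℝ F univ ∧
      ∀ x ∈ Metric.ball 0 R, |F x - G x| ≤ δ ∧ ‖fderiv ℝ F x - fderiv ℝ G x‖ ≤ δ := by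
  obtain ⟨R₁, hR₁⟩ := hGc.isBounded.subset_closedBall (0 : EuclideanSpace ℝ (Fin n))
  set ρ : ℝ := max (|R| + |R₁|) 1
  have hρ : 0 < ρ := lt_of_lt_of_le one_pos (le_max_right _ _)
  set B : Set (EuclideanSpace ℝ (Fin n)) := Metric.closedBall 0 ρ with hB
  have hBm : MeasurableSet B := measurableSet_closedBall
  obtain ⟨K, hK⟩ := ContDiff.lipschitzWith_of_hasCompactSupport hGc hG (by simp)
  obtain ⟨K', hK'⟩ := ContDiff.lipschitzWith_of_hasCompactSupport (hGc.fderiv ℝ)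
    (hG.fderiv_right (m := (⊤ : ℕ∞)) (by simp)) (by simp)
  obtain ⟨k, hk, hk'⟩ := ((eventually_norm_average_sub_le volume hρ hK hδ).and
    (eventually_norm_average_sub_le volume hρ hK' hδ)).exists
  set I : ℝ := ∫ z in B, (ρ ^ 2 - ‖z‖ ^ 2) ^ k
  set f : EuclideanSpace ℝ (Fin n) → ℝ := fun x => I⁻¹ •
    ∫ z in B, (ρ ^ 2 - ‖z‖ ^ 2) ^ k • G (x - z) with hf
  set F : EuclideanSpace ℝ (Fin n) → ℝ := fun x => I⁻¹ *
    ∫ y, (ρ ^ 2 - ‖x - y‖ ^ 2) ^ k * G y with hF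
  have hfF : EqOn F f (Metric.ball 0 R) := by
    intro x hx
    have hsub := integral_sub_left_eq_self
      (fun y => (ρ ^ 2 - ‖x - y‖ ^ 2) ^ k * G y) volume x
    simp only [sub_sub_cancel] at hsub
    simp only [hF, hf, smul_eq_mul]
    rw [← hsub, setIntegral_eq_integral_of_forall_compl_eq_zero]
    intro z hz
    have : G (x - z) = 0 := by
      by_contra hne
      have h1 : ‖x - z‖ ≤ R₁ := by simpa using hR₁ (subset_tsupport _ hne)
      have h2 : ‖x‖ < R := by simpa using hx
      refine hz ?_
      rw [hB, mem_closedBall_zero_iff]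
      calc ‖z‖ = ‖x - (x - z)‖ := by rw [sub_sub_cancel]
        _ ≤ ‖x‖ + ‖x - z‖ := norm_sub_le _ _
        _ ≤ |R| + |R₁| := add_le_add (h2.le.trans (le_abs_self R)) (h1.trans (le_abs_self R₁))
        _ ≤ ρ := le_max_left _ _
    simp [this]
  have hfd : ∀ x, HasFDerivAt f
      (I⁻¹ • ∫ z in B, (ρ ^ 2 - ‖z‖ ^ 2) ^ k • fderiv ℝ G (x - z)) x := by
    intro x
    have hloc : LocallyIntegrable
        (B.indicator fun z : EuclideanSpace ℝ (Fin n) => (ρ ^ 2 - ‖z‖ ^ 2) ^ k) volume := by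
      refine (IntegrableOn.integrable_indicator ?_ measurableSet_closedBall).locallyIntegrable
      exact (by fun_prop : Continuous fun z : EuclideanSpace ℝ (Fin n) =>
        (ρ ^ 2 - ‖z‖ ^ 2) ^ k).continuousOn.integrableOn_compact (isCompact_closedBall _ _)
    have key := hGc.hasFDerivAt_convolution_right (ContinuousLinearMap.lsmul ℝ ℝ) hloc
      (hG.of_le (by simp)) x
    have e₁ : ∀ y, MeasureTheory.convolution
        (B.indicator fun z : EuclideanSpace ℝ (Fin n) => (ρ ^ 2 - ‖z‖ ^ 2) ^ k) G
        (ContinuousLinearMap.lsmul ℝ ℝ) volume y =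
        ∫ z in B, (ρ ^ 2 - ‖z‖ ^ 2) ^ k • G (y - z) := by
      intro y
      rw [convolution_def, ← integral_indicator hBm]
      congr 1
      funext z
      by_cases hz : z ∈ B <;> simp [hz]
    have e₂ : MeasureTheory.convolution
        (B.indicator fun z : EuclideanSpace ℝ (Fin n) => (ρ ^ 2 - ‖z‖ ^ 2) ^ k) (fderiv ℝ G)
        ((ContinuousLinearMap.lsmul ℝ ℝ).precompR (EuclideanSpace ℝ (Fin n))) volume x =
        ∫ z in B, (ρ ^ 2 - ‖z‖ ^ 2) ^ k • fderiv ℝ G (x - z) := by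
      rw [convolution_def, ← integral_indicator hBm]
      congr 1
      funext z
      by_cases hz : z ∈ B
      · ext w
        simp [hz, ContinuousLinearMap.precompR_apply]
      · simp [hz]
    rw [e₂] at key
    exact (key.congr_of_eventuallyEq (Eventually.of_forall fun y => (e₁ y).symm)).const_smul I⁻¹
  refine ⟨F, analyticOnNhd_const.mul
    (analyticOnNhd_integral_pow_mul _ _ hG.continuous hGc), fun x hx => ⟨?_, ?_⟩⟩
  · rw [hfF hx, ← Real.norm_eq_abs]
    exact hk x
  · rw [(hfF.eventuallyEq_of_mem (Metric.isOpen_ball.mem_nhds hx)).fderiv_eq, (hfd x).fderiv]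
    exact hk' x

end Approximation

section Diffeomorphism

open Set Filter Topology

theorem exists_contDiff_inverse_id_add {E : Type*} [NormedAddCommGroup E] [NormedSpace ℝ E]
    [CompleteSpace E] {u : E → E} (hu : ContDiff ℝ (⊤ : ℕ∞) u)
    (hd : ∀ x, ‖fderiv ℝ u x‖ ≤ 1 / 2) :
    ∃ Ψ : E → E, ContDiff ℝ (⊤ : ℕ∞) Ψ ∧ Function.LeftInverse (fun x => x + u x) Ψ ∧
      Function.RightInverse (fun x => x + u x) Ψ := by
  have hdiff : Differentiable ℝ u := hu.differentiable (by simp)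
  have happ : ApproximatesLinearOn (fun x => x + u x)
      ((ContinuousLinearEquiv.refl ℝ E : E ≃L[ℝ] E) : E →L[ℝ] E) univ (1 / 2 : NNReal) := by
    intro x _ y _
    have h := (lipschitzWith_of_nnnorm_fderiv_le (C := 1 / 2) hdiff fun z => by
      exact_mod_cast hd z).norm_sub_le x y
    have e : x + u x - (y + u y) - (x - y) = u x - u y := by abel
    simpa [e] using h
  have hN : Subsingleton E ∨ (1 / 2 : NNReal) <
      ‖((ContinuousLinearEquiv.refl ℝ E).symm : E →L[ℝ] E)‖₊⁻¹ := by
    rcases subsingleton_or_nontrivial E with h | h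
    · exact Or.inl h
    · right
      have : ‖((ContinuousLinearEquiv.refl ℝ E).symm : E →L[ℝ] E)‖₊ = 1 := by
        simp
      rw [this, inv_one]
      exact NNReal.half_lt_self one_ne_zero
  set e := happ.toHomeomorph (fun x => x + u x) hN with he
  have hsmooth : ContDiff ℝ (⊤ : ℕ∞) e := contDiff_id.add hu
  have hderiv : ∀ x, HasFDerivAt e ((ContinuousLinearEquiv.ofUnit (Units.oneSub (-fderiv ℝ u x)
      (by rw [norm_neg]; linarith [hd x])) : E ≃L[ℝ] E) : E →L[ℝ] E) x := by
    intro x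
    have h := (hasFDerivAt_id x).add (hdiff x).hasFDerivAt
    refine h.congr_fderiv ?_
    ext v
    change v + fderiv ℝ u x v = (1 - -fderiv ℝ u x : E →L[ℝ] E) v
    simp
  exact ⟨e.symm, e.contDiff_symm hderiv hsmooth, e.apply_symm_apply, e.symm_apply_apply⟩

end Diffeomorphism

section Displacement

open Set Filter Topology

/-- If `P` vanishes for zero parameter, then parameters that are `C^1`-small on a large ball yield
`C^1`-small displacements. -/
theorem exists_small_displacement {E : Type*} [NormedAddCommGroup E] [NormedSpace ℝ E]
    {P : E × ℝ → E} (hP : ContDiff ℝ (⊤ : ℕ∞) P) (hPc : HasCompactSupport P)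
    (hP0 : ∀ y, P (y, 0) = 0) {m : ℝ} (hm : 0 < m) :
    ∃ R δ : ℝ, 0 < δ ∧ ∀ D : E → ℝ, ContDiff ℝ (⊤ : ℕ∞) D →
      (∀ y ∈ Metric.ball 0 R, |D y| ≤ δ ∧ ‖fderiv ℝ D y‖ ≤ δ) →
      ∀ y, ‖P (y, D y)‖ < m ∧ ‖fderiv ℝ (fun z => P (z, D z)) y‖ ≤ 1 / 2 := by
  obtain ⟨R, hR⟩ := (hPc.image continuous_fst).isBounded.subset_ball (0 : E)
  obtain ⟨K, hK⟩ := ContDiff.lipschitzWith_of_hasCompactSupport hPc hP (by simp)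
  obtain ⟨L, hL⟩ := ContDiff.lipschitzWith_of_hasCompactSupport (hPc.fderiv ℝ)
    (hP.fderiv_right (m := (⊤ : ℕ∞)) (by simp)) (by simp)
  set S : ℝ := K + L + 1
  have hS : 0 < S := by positivity
  refine ⟨R, min m (1 / 2) / S / 2, by positivity, fun D hD hDδ y => ?_⟩
  set δ : ℝ := min m (1 / 2) / S / 2 with hδ
  have hδ0 : 0 < δ := by positivity
  have hSδ : S * δ = min m (1 / 2) / 2 := by rw [hδ]; field_simp
  have hmin₁ := min_le_left m (1 / 2)
  have hmin₂ := min_le_right m (1 / 2)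
  have hdiff : DifferentiableAt ℝ P (y, D y) := hP.differentiable (by simp) _
  have hder : HasFDerivAt (fun z => P (z, D z))
      ((fderiv ℝ P (y, D y)).comp ((ContinuousLinearMap.id ℝ E).prod (fderiv ℝ D y))) y :=
    hdiff.hasFDerivAt.comp y
      ((hasFDerivAt_id y).prodMk (hD.differentiable (by simp) y).hasFDerivAt)
  by_cases hy : (y, D y) ∈ tsupport P
  · obtain ⟨h₁, h₂⟩ := hDδ y (hR ⟨_, hy, rfl⟩)
    constructor
    · have h := hK.norm_sub_le (y, D y) (y, 0)
      simp only [hP0, sub_zero, Prod.mk_sub_mk, sub_self, Prod.norm_mk, norm_zero,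
        Real.norm_eq_abs] at h
      rw [max_eq_right (abs_nonneg _)] at h
      have hKδ : K * |D y| ≤ S * δ :=
        mul_le_mul (by simp only [S]; linarith [L.coe_nonneg]) h₁ (abs_nonneg _) hS.le
      linarith
    · rw [hder.fderiv]
      refine ContinuousLinearMap.opNorm_le_bound _ (by norm_num) fun v => ?_
      have hzero : fderiv ℝ P (y, 0) (v, 0) = 0 := by
        have h : HasFDerivAt (fun z => P (z, (0 : ℝ))) ((fderiv ℝ P (y, 0)).comp
            ((ContinuousLinearMap.id ℝ E).prod 0)) y :=
          (hP.differentiable (by simp) (y, 0)).hasFDerivAt.comp y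
            ((hasFDerivAt_id y).prodMk (hasFDerivAt_const _ y))
        simp only [hP0] at h
        simpa using DFunLike.congr_fun (h.unique (hasFDerivAt_const _ y)) v
      have hsplit : (fderiv ℝ P (y, D y)) (v, fderiv ℝ D y v) =
          (fderiv ℝ P (y, D y) - fderiv ℝ P (y, 0)) (v, 0) +
            fderiv ℝ P (y, D y) (0, fderiv ℝ D y v) := by
        rw [sub_apply, hzero, sub_zero, ← map_add]
        simp
      have hL' : ‖fderiv ℝ P (y, D y) - fderiv ℝ P (y, 0)‖ ≤ L * δ := by
        have h := hL.norm_sub_le (y, D y) (y, 0)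
        simp only [sub_zero, Prod.mk_sub_mk, sub_self, Prod.norm_mk, norm_zero,
          Real.norm_eq_abs] at h
        rw [max_eq_right (abs_nonneg _)] at h
        exact h.trans (mul_le_mul_of_nonneg_left h₁ L.coe_nonneg)
      have hK' : ‖fderiv ℝ P (y, D y)‖ ≤ K := norm_fderiv_le_of_lipschitz ℝ hK
      have b₁ : ‖(fderiv ℝ P (y, D y) - fderiv ℝ P (y, 0)) (v, 0)‖ ≤ L * δ * ‖v‖ := by
        simpa using ContinuousLinearMap.le_of_opNorm_le _ hL' ((v, 0) : E × ℝ)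
      have b₂ : ‖fderiv ℝ P (y, D y) (0, fderiv ℝ D y v)‖ ≤ K * (δ * ‖v‖) := by
        have h := ContinuousLinearMap.le_of_opNorm_le _ hK' ((0, fderiv ℝ D y v) : E × ℝ)
        rw [Prod.norm_mk, norm_zero, max_eq_right (norm_nonneg _)] at h
        exact h.trans (mul_le_mul_of_nonneg_left
          (ContinuousLinearMap.le_of_opNorm_le _ h₂ v) K.coe_nonneg)
      change ‖(fderiv ℝ P (y, D y)) (v, fderiv ℝ D y v)‖ ≤ 1 / 2 * ‖v‖
      rw [hsplit]
      calc _ ≤ L * δ * ‖v‖ + K * (δ * ‖v‖) := (norm_add_le _ _).trans (add_le_add b₁ b₂)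
        _ ≤ S * δ * ‖v‖ := by simp only [S]; nlinarith [mul_nonneg hδ0.le (norm_nonneg v)]
        _ ≤ 1 / 2 * ‖v‖ := mul_le_mul_of_nonneg_right (by linarith) (norm_nonneg v)
  · rw [hder.fderiv, image_eq_zero_of_notMem_tsupport hy,
      fderiv_of_notMem_tsupport (𝕜 := ℝ) hy]
    simpa using hm

end Displacement

theorem stmt14 (n : ℕ) (hn : 2 ≤ n) (c : Set (EuclideanSpace ℝ (Fin n)))
    (hc : IsCompact c) (hhyp : IsSmoothHypersurface c) (ε : ℝ) (hε : 0 < ε) :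
    ∃ Ψ Φ : EuclideanSpace ℝ (Fin n) → EuclideanSpace ℝ (Fin n),
      ContDiff ℝ (⊤ : ℕ∞) Ψ ∧ ContDiff ℝ (⊤ : ℕ∞) Φ ∧
      Function.LeftInverse Φ Ψ ∧ Function.RightInverse Φ Ψ ∧
      (∀ x : EuclideanSpace ℝ (Fin n), ‖Ψ x - x‖ < ε) ∧
      ∃ V : Set (EuclideanSpace ℝ (Fin n)), IsOpen V ∧ Ψ '' c ⊆ V ∧
        ∃ F : EuclideanSpace ℝ (Fin n) → ℝ, AnalyticOnNhd ℝ F V ∧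
          (∀ y ∈ V, fderiv ℝ F y ≠ 0) ∧
          Ψ '' c = {y ∈ V | F y = 0} := by
  obtain ⟨G, W, hG, hGc, hW, hcW, hdG, hGW⟩ := hhyp.exists_definingFunction hc
  obtain ⟨P, hP, hPc, hP0, N, δ, hN, hcN, hδ, hPN⟩ :=
    exists_straightening hG hc fun y hy => hdG y (hcW hy)
  obtain ⟨κ, hκ, hκN⟩ := hc.exists_thickening_subset_open hN hcN
  obtain ⟨R₁, hR₁⟩ := (hc.isBounded.thickening (δ := κ)).subset_ball 0
  obtain ⟨R₂, δ₂, hδ₂, hsmall⟩ := exists_small_displacement hP hPc hP0 (lt_min hε hκ)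
  obtain ⟨F, hF, hFG⟩ := exists_analytic_approximation hG hGc (max R₁ R₂)
    (lt_min (half_pos hδ) hδ₂)
  have hFs : ContDiff ℝ (⊤ : ℕ∞) F := contDiffOn_univ.1 hF.contDiffOn_of_completeSpace
  have hFd : Differentiable ℝ F := hFs.differentiable (by simp)
  have hGd : Differentiable ℝ G := hG.differentiable (by simp)
  set u : EuclideanSpace ℝ (Fin n) → EuclideanSpace ℝ (Fin n) := fun y => P (y, F y - G y) with hu
  have hus : ContDiff ℝ (⊤ : ℕ∞) u := hP.comp (contDiff_id.prodMk (hFs.sub hG))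
  have hub := hsmall (fun y => F y - G y) (hFs.sub hG) fun y hy => by
    have h := hFG y (Metric.ball_subset_ball (le_max_right _ _) hy)
    rw [fderiv_fun_sub (hFd y) (hGd y)]
    exact ⟨h.1.trans (min_le_right _ _), h.2.trans (min_le_right _ _)⟩
  obtain ⟨Ψ, hΨ, hl, hr⟩ := exists_contDiff_inverse_id_add hus fun y => (hub y).2
  have hΦ : ContDiff ℝ (⊤ : ℕ∞) fun y => y + u y := contDiff_id.add hus
  have hΨsub : ∀ x, ‖Ψ x - x‖ < min ε κ := by
    intro x
    have h : Ψ x + u (Ψ x) = x := hl x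
    have h' : Ψ x - x = -u (Ψ x) := by
      rw [eq_neg_iff_add_eq_zero, sub_add_eq_add_sub, h, sub_self]
    rw [h', norm_neg]
    exact (hub _).1
  set V : Set (EuclideanSpace ℝ (Fin n)) :=
    (N ∩ Metric.ball 0 R₁) ∩ (fun y => y + u y) ⁻¹' W with hV
  have hVo : IsOpen V := (hN.inter Metric.isOpen_ball).inter (hW.preimage hΦ.continuous)
  have hVF : ∀ y ∈ V, G (y + u y) = F y := by
    rintro y ⟨⟨hyN, hyR⟩, -⟩
    have h := (hFG y (Metric.ball_subset_ball (le_max_left _ _) hyR)).1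
    rw [hPN y hyN _ (lt_of_le_of_lt (h.trans (min_le_left _ _)) (half_lt_self hδ))]
    ring
  have hΨV : Ψ '' c ⊆ V := by
    rintro _ ⟨x, hx, rfl⟩
    have hmem : Ψ x ∈ Metric.thickening κ c :=
      Metric.mem_thickening_iff.2 ⟨x, hx, by
        rw [dist_eq_norm]
        exact (hΨsub x).trans_le (min_le_right _ _)⟩
    refine ⟨⟨hκN hmem, hR₁ hmem⟩, ?_⟩
    have h : Ψ x + u (Ψ x) = x := hl x
    rw [Set.mem_preimage, h]
    exact hcW hx
  refine ⟨Ψ, fun y => y + u y, hΨ, hΦ, hl, hr, fun x => (hΨsub x).trans_le (min_le_left _ _),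
    V, hVo, hΨV, F, hF.mono (Set.subset_univ _), fun y hy hdF => ?_, ?_⟩
  · have hΨy : Ψ (y + u y) = y := hr y
    have hev : Filter.EventuallyEq (nhds (y + u y)) G (F ∘ Ψ) := by
      have : Ψ ⁻¹' V ∈ nhds (y + u y) :=
        hΨ.continuous.continuousAt.preimage_mem_nhds (hΨy.symm ▸ hVo.mem_nhds hy)
      filter_upwards [this] with z hz
      have h : Ψ z + u (Ψ z) = z := hl z
      rw [Function.comp_apply, ← hVF _ hz, h]
    refine hdG _ hy.2 ?_
    rw [hev.fderiv_eq, fderiv_comp _ (hFd _) (hΨ.differentiable (by simp) _), hΨy, hdF,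
      ContinuousLinearMap.zero_comp]
  · ext y
    constructor
    · rintro ⟨x, hx, rfl⟩
      have hxV : Ψ x ∈ V := hΨV ⟨x, hx, rfl⟩
      have h : Ψ x + u (Ψ x) = x := hl x
      refine ⟨hxV, ?_⟩
      rw [← hVF _ hxV, h]
      exact (hGW x (hcW hx)).2 hx
    · rintro ⟨hyV, hy0⟩
      rw [← hVF y hyV] at hy0
      exact ⟨y + u y, (hGW _ hyV.2).1 hy0, hr y⟩
end
end
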